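/- Let τ ∈ 𝔯₋ˣ and z ∈ 𝔫. Since ad z is a nilpotent endomorphism of 𝔤, exp(ad z) is a well-defined automorphism of 𝔤. If Φ(exp(ad z)(τ)) ∈ 𝔯₋, then Φ(exp(ad z)(τ)) = τ. Consequently, for distinct τ, τ′ ∈ 𝔯₋ˣ, the coadjoint N-orbits {Φ(exp(ad z)(τ)) : z ∈ 𝔫} and {Φ(exp(ad z)(τ′)) : z ∈ 𝔫} are disjoint. -/

import Mathlib

open scoped InnerProductSpace BigOperators

structure RootSystemData (V : Type*) [NormedAddCommGroup V] [InnerProductSpace ℝ V] where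
  Δ : Set V
  finite : Δ.Finite
  span_top : Submodule.span ℝ Δ = ⊤
  zero_not_mem : (0 : V) ∉ Δ
  neg_mem : ∀ α ∈ Δ, -α ∈ Δ
  reduced : ∀ α ∈ Δ, ∀ t : ℝ, t • α ∈ Δ → t = 1 ∨ t = -1
  crystal : ∀ α ∈ Δ, ∀ β ∈ Δ, ∃ n : ℤ, 2 * ⟪α, β⟫_ℝ = (n : ℝ) * ⟪β, β⟫_ℝ
  reflect_mem : ∀ α ∈ Δ, ∀ β ∈ Δ, α - (2 * ⟪α, β⟫_ℝ / ⟪β, β⟫_ℝ) • β ∈ Δ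
  Pos : Set V
  pos_subset : Pos ⊆ Δ
  mem_or_neg : ∀ α ∈ Δ, α ∈ Pos ∨ -α ∈ Pos
  not_neg_mem : ∀ α ∈ Pos, -α ∉ Pos
  pos_add : ∀ α ∈ Pos, ∀ β ∈ Pos, α + β ∈ Δ → α + β ∈ Pos

namespace RootSystemData

variable {V : Type*} [NormedAddCommGroup V] [InnerProductSpace ℝ V] (R : RootSystemData V)

/-- The set of simple roots: indecomposable positive roots. -/
def Simple : Set V := {α ∈ R.Pos | ¬ ∃ β ∈ R.Pos, ∃ γ ∈ R.Pos, α = β + γ}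

/-- The support `Π(φ)` of a positive root: the simple roots needed to express `φ`. -/
def support (φ : V) : Set V := {α ∈ R.Simple | φ ∉ Submodule.span ℝ (R.Simple \ {α})}

/-- The root subsystem `Δ(φ)`: all roots lying in the span of the support of `φ`. -/
def sub (φ : V) : Set V := {ψ ∈ R.Δ | ψ ∈ Submodule.span ℝ (R.support φ)}

/-- The positive roots `Δ(φ)₊` of the subsystem `Δ(φ)`. -/
def posSub (φ : V) : Set V := R.sub φ ∩ R.Pos

/-- `x` is a nonnegative integer combination of positive roots. -/
def NonnegComb (x : V) : Prop :=
  ∃ c : V →₀ ℕ, ↑c.support ⊆ R.Pos ∧ x = c.sum fun α n => (n : ℝ) • α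

/-- `β` is the highest root of the subset `S`. -/
def IsHighest (S : Set V) (β : V) : Prop :=
  β ∈ S ∧ β ∈ R.Pos ∧ ∀ ψ ∈ S, R.NonnegComb (β - ψ)

/-- `β` is locally high: it is the highest root of `Δ(β)`. -/
def LocallyHigh (β : V) : Prop := β ∈ R.Pos ∧ R.IsHighest (R.sub β) β

/-- `E(β) = {φ ∈ Δ(β) : (φ,β) > 0}`. -/
def E (β : V) : Set V := {φ ∈ R.sub β | 0 < ⟪φ, β⟫_ℝ}

/-- `Δ(β)° = {φ ∈ Δ(β) : (φ,β) = 0}`. -/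
def orth (β : V) : Set V := {φ ∈ R.sub β | ⟪φ, β⟫_ℝ = 0}

/-- Strong orthogonality of two roots. -/
def StronglyOrth (φ ψ : V) : Prop := φ + ψ ∉ R.Δ ∧ φ - ψ ∉ R.Δ


/-- Half the sum of the positive roots of `Δ(β)`. -/
noncomputable def rho (β : V) : V := (2⁻¹ : ℝ) • ∑ᶠ φ ∈ R.posSub β, φ

/-- The dual Coxeter number of `Δ(β)`, `⟨ρ_β, β^∨⟩ + 1`. -/
noncomputable def dualCoxeter (β : V) : ℝ := 2 * ⟪R.rho β, β⟫_ℝ / ⟪β, β⟫_ℝ + 1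

end RootSystemData

/-- A finite set of vectors is irreducible if it is nonempty and admits no splitting into
two nonempty mutually orthogonal pieces. -/
def IsIrred {V : Type*} [NormedAddCommGroup V] [InnerProductSpace ℝ V] (S : Set V) : Prop :=
  S.Nonempty ∧ ¬ ∃ A B : Set V, A ∪ B = S ∧ A ∩ B = ∅ ∧ A.Nonempty ∧ B.Nonempty ∧
    ∀ a ∈ A, ∀ b ∈ B, ⟪a, b⟫_ℝ = 0

/-- `C` is an irreducible component of `S`. -/
def IsComponent {V : Type*} [NormedAddCommGroup V] [InnerProductSpace ℝ V]
    (S C : Set V) : Prop :=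
  C ⊆ S ∧ IsIrred C ∧ ∀ a ∈ C, ∀ b ∈ S \ C, ⟪a, b⟫_ℝ = 0

/-- The reflection `s_β` in the (co)vector `β`. -/
noncomputable def reflectRoot {V : Type*} [NormedAddCommGroup V] [InnerProductSpace ℝ V]
    (β v : V) : V := v - (2 * ⟪v, β⟫_ℝ / ⟪β, β⟫_ℝ) • β

namespace RootSystemData

variable {V : Type*} [NormedAddCommGroup V] [InnerProductSpace ℝ V] (R : RootSystemData V)

/-- A chain cascade: a nonempty list whose head is the highest root of an irreducible
component of `Δ`, and each subsequent entry is the highest root of an irreducible component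
of `Δ(previous)°`. -/
def IsChainCascade (l : List V) : Prop :=
  l ≠ [] ∧
  (∀ b ∈ l.head?, ∃ C, IsComponent R.Δ C ∧ R.IsHighest C b) ∧
  l.Chain' fun γ δ => ∃ C, IsComponent (R.orth γ) C ∧ R.IsHighest C δ

/-- The cascade `ℬ` of roots: all positive roots belonging to some chain cascade. -/
def cascade : Set V := {β | ∃ l, R.IsChainCascade l ∧ β ∈ l}

/-- `l` is the chain cascade `C(φ)` associated to the positive root `φ`. -/
def IsCascadeChainOf (φ : V) (l : List V) : Prop :=
  R.IsChainCascade l ∧ (∀ β ∈ l, φ ∈ R.sub β) ∧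
  (∀ β ∈ l.dropLast, ⟪φ, β⟫_ℝ = 0) ∧ ∀ β ∈ l.getLast?, 0 < ⟪φ, β⟫_ℝ

end RootSystemData

section LieSetup

variable (V : Type*) [NormedAddCommGroup V] [InnerProductSpace ℝ V]
  (L : Type*) [LieRing L] [LieAlgebra ℂ L] [Module.Finite ℂ L]

/-- A triangular decomposition of a finite-dimensional complex semisimple Lie algebra `L`,
with Cartan subalgebra `H`, root system `Δ` (realized in the real inner product space `V`,
the inner product being the one induced by the Killing form), chosen root vectors `e φ`,
and the projection `Φ : L → 𝔫₋` with kernel `𝔟 = 𝔥 ⊕ 𝔫`. -/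
structure CascadeLieData extends RootSystemData V where
  /-- the root vectors `e_φ` -/
  e : V → L
  /-- the Cartan subalgebra `𝔥` -/
  H : LieSubalgebra ℂ L
  /-- the realization of `V` inside `𝔥*`: each `φ ∈ V` gives a functional on `𝔥` -/
  wt : V →ₗ[ℝ] (H →ₗ[ℂ] ℂ)
  wt_inj : Function.Injective wt
  e_ne : ∀ φ ∈ Δ, e φ ≠ 0
  indep : LinearIndependent ℂ fun φ : Δ => e (φ : V)
  root_vec : ∀ x : H, ∀ φ ∈ Δ, ⁅(x : L), e φ⁆ = wt φ x • e φ
  bracket_add : ∀ φ ∈ Δ, ∀ ψ ∈ Δ, φ + ψ ∈ Δ →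
    ∃ c : ℂ, c ≠ 0 ∧ ⁅e φ, e ψ⁆ = c • e (φ + ψ)
  bracket_zero : ∀ φ ∈ Δ, ∀ ψ ∈ Δ, φ + ψ ∉ Δ → φ + ψ ≠ 0 → ⁅e φ, e ψ⁆ = 0
  bracket_opp : ∀ φ ∈ Δ, ⁅e φ, e (-φ)⁆ ∈ H
  span_eq_top : H.toSubmodule ⊔ Submodule.span ℂ (e '' Δ) = ⊤
  killing_pair : ∀ φ ∈ Δ, killingForm ℂ L (e φ) (e (-φ)) ≠ 0
  killing_orth : ∀ φ ∈ Δ, ∀ ψ ∈ Δ, φ + ψ ≠ 0 → killingForm ℂ L (e φ) (e ψ) = 0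
  /-- the projection `Φ : 𝔤 → 𝔫₋` with kernel `𝔟` -/
  Φ : L →ₗ[ℂ] L
  Φ_neg : ∀ z ∈ Submodule.span ℂ (e '' (Neg.neg '' Pos)), Φ z = z
  Φ_b : ∀ z ∈ H.toSubmodule ⊔ Submodule.span ℂ (e '' Pos), Φ z = 0

end LieSetup

namespace CascadeLieData

variable {V : Type*} [NormedAddCommGroup V] [InnerProductSpace ℝ V]
  {L : Type*} [LieRing L] [LieAlgebra ℂ L] [Module.Finite ℂ L]
  (C : CascadeLieData V L)

/-- The nilradical `𝔫 = ⊕_{φ∈Δ₊} 𝔤_φ`. -/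
def nSub : Submodule ℂ L := Submodule.span ℂ (C.e '' C.Pos)

/-- The opposite nilradical `𝔫₋`. -/
def nMinus : Submodule ℂ L := Submodule.span ℂ (C.e '' (Neg.neg '' C.Pos))

/-- The Borel subalgebra `𝔟 = 𝔥 ⊕ 𝔫` (as a subspace). -/
def bSub : Submodule ℂ L := C.H.toSubmodule ⊔ C.nSub

/-- `𝔯 = span{e_β : β ∈ ℬ}`. -/
def rSub : Submodule ℂ L := Submodule.span ℂ (C.e '' C.toRootSystemData.cascade)

/-- `𝔯₋ = span{e_{−β} : β ∈ ℬ}`. -/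
def rMinus : Submodule ℂ L :=
  Submodule.span ℂ (C.e '' (Neg.neg '' C.toRootSystemData.cascade))

/-- `𝔯₋ˣ`: the elements of `𝔯₋` all of whose coefficients are nonzero. -/
def rMinusX : Set L :=
  {z | ∃ a : V → ℂ, (∀ β ∈ C.toRootSystemData.cascade, a β ≠ 0) ∧
    z = ∑ᶠ β ∈ C.toRootSystemData.cascade, a β • C.e (-β)}

/-- `𝔰 = span{e_φ : φ ∈ Δ₊ \ ℬ}`. -/
def sSub : Submodule ℂ L :=
  Submodule.span ℂ (C.e '' (C.Pos \ C.toRootSystemData.cascade))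

/-- `𝔰₋ = span{e_{−φ} : φ ∈ Δ₊ \ ℬ}`. -/
def sMinus : Submodule ℂ L :=
  Submodule.span ℂ (C.e '' (Neg.neg '' (C.Pos \ C.toRootSystemData.cascade)))

/-- `𝔰(β) = span{e_φ : φ ∈ E(β), φ ≠ β}`. -/
def sBeta (β : V) : Submodule ℂ L :=
  Submodule.span ℂ (C.e '' (C.toRootSystemData.E β \ {β}))

/-- `𝔰(−β) = span{e_{−φ} : φ ∈ E(β), φ ≠ β}`. -/
def sBetaMinus (β : V) : Submodule ℂ L :=
  Submodule.span ℂ (C.e '' (Neg.neg '' (C.toRootSystemData.E β \ {β})))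

/-- `𝔢(β) = span{e_φ : φ ∈ E(β)}`. -/
def eSub (β : V) : Submodule ℂ L := Submodule.span ℂ (C.e '' C.toRootSystemData.E β)

/-- `𝔤(β)`: the Lie subalgebra generated by the root spaces `𝔤_{±α}`, `α ∈ Π(β)`. -/
def gSub (β : V) : LieSubalgebra ℂ L :=
  LieSubalgebra.lieSpan ℂ L
    (C.e '' C.toRootSystemData.support β ∪ C.e '' (Neg.neg '' C.toRootSystemData.support β))

end CascadeLieData

/-- The exponential of a nilpotent endomorphism `f` (with `f ^ N = 0`), given by the
truncated exponential series `Σ_{i<N} f^i / i!`. -/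
noncomputable def expNil {L : Type*} [AddCommGroup L] [Module ℂ L]
    (f : Module.End ℂ L) (N : ℕ) : Module.End ℂ L :=
  ∑ i ∈ Finset.range N, ((i.factorial : ℂ))⁻¹ • f ^ i

/-- The coadjoint `N`-orbit of `τ`: all `Φ(exp(ad z)(τ))` for `z ∈ 𝔫`. -/
noncomputable def coadjointOrbit {V : Type*} [NormedAddCommGroup V] [InnerProductSpace ℝ V]
    {L : Type*} [LieRing L] [LieAlgebra ℂ L] [Module.Finite ℂ L]
    (C : CascadeLieData V L) (τ : L) : Set L :=
  {x | ∃ z ∈ C.nSub, ∃ N : ℕ, (LieAlgebra.ad ℂ L z) ^ N = 0 ∧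
    x = C.Φ (expNil (LieAlgebra.ad ℂ L z) N τ)}

namespace RootSystemData

variable {V : Type*} [NormedAddCommGroup V] [InnerProductSpace ℝ V] (R : RootSystemData V)

section Basics

variable {R}

lemma ne_zero_of_mem {α : V} (hα : α ∈ R.Δ) : α ≠ 0 :=
  fun h => R.zero_not_mem (h ▸ hα)

lemma inner_self_pos_of_mem {α : V} (hα : α ∈ R.Δ) : 0 < ⟪α, α⟫_ℝ :=
  real_inner_self_pos.2 (ne_zero_of_mem hα)

lemma pos_or_neg_pos {α : V} (hα : α ∈ R.Δ) : α ∈ R.Pos ∨ -α ∈ R.Pos := R.mem_or_neg α hα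

/-- The reflection of a root, with the Cartan integer named. -/
lemma exists_reflect {α β : V} (hα : α ∈ R.Δ) (hβ : β ∈ R.Δ) :
    ∃ n : ℤ, 2 * ⟪α, β⟫_ℝ = (n : ℝ) * ⟪β, β⟫_ℝ ∧ α - (n : ℝ) • β ∈ R.Δ := by
  obtain ⟨n, hn⟩ := R.crystal α hα β hβ
  have hb := inner_self_pos_of_mem hβ
  refine ⟨n, hn, ?_⟩
  have := R.reflect_mem α hα β hβ
  rwa [hn, mul_div_cancel_right₀ _ hb.ne'] at this

lemma add_mem_of_inner_neg {α β : V} (hα : α ∈ R.Δ) (hβ : β ∈ R.Δ) (h : ⟪α, β⟫_ℝ < 0)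
    (hne : α ≠ -β) : α + β ∈ R.Δ := by
  obtain ⟨n, hn, hn'⟩ := exists_reflect hα hβ
  obtain ⟨m, hm, hm'⟩ := exists_reflect hβ hα
  have ha := inner_self_pos_of_mem hα
  have hb := inner_self_pos_of_mem hβ
  rw [real_inner_comm] at hm
  have hn0 : n < 0 := by
    by_contra! h0
    have : (0 : ℝ) ≤ n := by exact_mod_cast h0
    nlinarith [mul_nonneg this hb.le]
  have hm0 : m < 0 := by
    by_contra! h0
    have : (0 : ℝ) ≤ m := by exact_mod_cast h0
    nlinarith [mul_nonneg this ha.le]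
  by_cases h1 : n = -1
  · subst h1; simpa using hn'
  by_cases h2 : m = -1
  · subst h2; simpa [add_comm] using hm'
  exfalso
  have hn2 : (n : ℝ) ≤ -2 := by exact_mod_cast (by omega : n ≤ -2)
  have hm2 : (m : ℝ) ≤ -2 := by exact_mod_cast (by omega : m ≤ -2)
  set a := ⟪α, α⟫_ℝ
  set b := ⟪β, β⟫_ℝ
  set c := ⟪α, β⟫_ℝ
  have hc1 : c ≤ -b := by nlinarith
  have hc2 : c ≤ -a := by nlinarith
  have hcs : a * b ≤ c * c := by nlinarith
  have hz : b • α - c • β = 0 := by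
    rw [← inner_self_eq_zero (𝕜 := ℝ)]
    apply le_antisymm _ real_inner_self_nonneg
    simp only [inner_sub_left, inner_sub_right, real_inner_smul_left, real_inner_smul_right,
      real_inner_comm α β]
    change b * (b * a) - b * (c * c) - (c * (b * c) - c * (c * b)) ≤ 0
    nlinarith
  have hα' : α = (c / b) • β := by
    rw [div_eq_inv_mul, mul_smul, ← sub_eq_zero.1 hz, smul_smul, inv_mul_cancel₀ hb.ne', one_smul]
  have hcb : c / b < 0 := div_neg_of_neg_of_pos h hb
  rcases R.reduced β hβ (c / b) (hα' ▸ hα) with h3 | h3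
  · linarith
  · rw [h3] at hα'
    exact hne (by simpa using hα')

lemma sub_mem_of_inner_pos {α β : V} (hα : α ∈ R.Δ) (hβ : β ∈ R.Δ) (h : 0 < ⟪α, β⟫_ℝ)
    (hne : α ≠ β) : α - β ∈ R.Δ := by
  rw [sub_eq_add_neg]
  exact add_mem_of_inner_neg hα (R.neg_mem _ hβ) (by simpa using h) (by simpa using hne)

/-- For orthogonal roots, the sum is a root as soon as the difference is. -/
lemma add_mem_of_sub_mem {χ β : V} (hβ : β ∈ R.Δ) (h0 : ⟪χ, β⟫_ℝ = 0) (h : χ - β ∈ R.Δ) :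
    χ + β ∈ R.Δ := by
  have hb := inner_self_pos_of_mem hβ
  have := R.reflect_mem _ h _ hβ
  have e : 2 * ⟪χ - β, β⟫_ℝ / ⟪β, β⟫_ℝ = -2 := by
    rw [inner_sub_left, h0, div_eq_iff hb.ne']; ring
  rw [e] at this
  convert this using 1
  module

/-- A nonempty sum of positive roots is nonzero. -/
lemma multiset_sum_ne_zero (s : Multiset V) (hs : ∀ x ∈ s, x ∈ R.Pos) (h0 : s ≠ 0) :
    s.sum ≠ 0 := by
  induction hn : s.card using Nat.strong_induction_on generalizing s with
  | _ n ih =>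
  obtain ⟨a, ha⟩ := Multiset.exists_mem_of_ne_zero h0
  obtain ⟨t, rfl⟩ := Multiset.exists_cons_of_mem ha
  have hap := hs a ha
  intro hsum
  rw [Multiset.sum_cons] at hsum
  have hlt : ∃ x ∈ t, ⟪a, x⟫_ℝ < 0 := by
    by_contra! hall
    have h1 : 0 ≤ ⟪a, t.sum⟫_ℝ := by
      rw [show ⟪a, t.sum⟫_ℝ = innerₗ V a t.sum from rfl, map_multiset_sum]
      refine Multiset.sum_nonneg fun y hy => ?_
      obtain ⟨x, hx, rfl⟩ := Multiset.mem_map.1 hy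
      exact hall x hx
    rw [eq_neg_of_add_eq_zero_right hsum, inner_neg_right] at h1
    linarith [inner_self_pos_of_mem (R.pos_subset hap)]
  obtain ⟨x, hx, hneg⟩ := hlt
  obtain ⟨u, rfl⟩ := Multiset.exists_cons_of_mem hx
  have hxp : x ∈ R.Pos := hs x (Multiset.mem_cons_of_mem hx)
  have hax : a + x ∈ R.Pos := R.pos_add a hap x hxp <|
    add_mem_of_inner_neg (R.pos_subset hap) (R.pos_subset hxp) hneg fun h =>
      R.not_neg_mem x hxp (h ▸ hap)
  refine ih (((a + x) ::ₘ u).card) (by simp [← hn]) ((a + x) ::ₘ u) ?_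
    (Multiset.cons_ne_zero) rfl ?_
  · intro y hy
    rcases Multiset.mem_cons.1 hy with rfl | hy
    · exact hax
    · exact hs y (by simp [hy])
  · simpa [add_assoc] using hsum

/-- Induction on positive roots: every positive root is obtained from simple roots by
successively adding positive roots. -/
lemma pos_induction {p : V → Prop} (simple : ∀ α ∈ R.Simple, p α)
    (add : ∀ β ∈ R.Pos, ∀ γ ∈ R.Pos, p β → p γ → p (β + γ)) : ∀ β ∈ R.Pos, p β := by
  have : Finite R.Pos := (R.finite.subset R.pos_subset).to_subtype
  let r : R.Pos → R.Pos → Prop := fun γ β =>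
    ∃ s : Multiset V, (∀ x ∈ s, x ∈ R.Pos) ∧ s ≠ 0 ∧ (β : V) = γ + s.sum
  have : IsTrans R.Pos r := ⟨by
    rintro a b c ⟨s, hs, hs0, e⟩ ⟨t, ht, ht0, e'⟩
    refine ⟨s + t, fun x hx => ?_, by simp [hs0], by rw [e', e, Multiset.sum_add, add_assoc]⟩
    exact (Multiset.mem_add.1 hx).elim (hs x) (ht x)⟩
  have : Std.Irrefl r := ⟨by
    rintro a ⟨s, hs, hs0, e⟩
    exact multiset_sum_ne_zero s hs hs0 (by simpa using e)⟩
  have wf : WellFounded r := Finite.wellFounded_of_trans_of_irrefl r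
  intro β hβ
  suffices ∀ β : R.Pos, p β from this ⟨β, hβ⟩
  intro β
  induction β using wf.induction with
  | _ β ih =>
  by_cases hS : (β : V) ∈ R.Simple
  · exact simple _ hS
  · have : ∃ γ ∈ R.Pos, ∃ δ ∈ R.Pos, (β : V) = γ + δ := by
      by_contra h; exact hS ⟨β.2, h⟩
    obtain ⟨γ, hγ, δ, hδ, e⟩ := this
    rw [e]
    refine add γ hγ δ hδ (ih ⟨γ, hγ⟩ ⟨{δ}, by simpa using hδ, by simp, by simpa using e⟩)
      (ih ⟨δ, hδ⟩ ⟨{γ}, by simpa using hγ, by simp, by simpa [add_comm] using e⟩)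

lemma sub_pos_of_simple {α φ : V} (hα : α ∈ R.Simple) (hφ : φ ∈ R.Pos) (h : φ - α ∈ R.Δ) :
    φ - α ∈ R.Pos := by
  rcases pos_or_neg_pos h with h | h
  · exact h
  · exact absurd ⟨φ, hφ, _, h, by abel⟩ hα.2

lemma eq_simple_of_add_eq_smul {α : V} (hα : α ∈ R.Simple) (n : ℕ) :
    ∀ φ ∈ R.Pos, ∀ ψ ∈ R.Pos, φ + ψ = (n : ℝ) • α → φ = α ∧ ψ = α := by
  have hαΔ := R.pos_subset hα.1
  have ha := inner_self_pos_of_mem hαΔ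
  induction n with
  | zero =>
    intro φ hφ ψ hψ h
    exact absurd ((eq_neg_of_add_eq_zero_left (by simpa using h)) ▸ hφ) (R.not_neg_mem ψ hψ)
  | succ n ih =>
    have key : ∀ φ ∈ R.Pos, ∀ ψ ∈ R.Pos, φ + ψ = ((n + 1 : ℕ) : ℝ) • α → 0 < ⟪φ, α⟫_ℝ →
        φ = α ∧ ψ = α := by
      intro φ hφ ψ hψ h hpos
      have hmult : ∀ t : ℝ, t • α ∈ R.Pos → t • α = α := by
        intro t ht
        rcases R.reduced α hαΔ t (R.pos_subset ht) with rfl | rfl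
        · simp
        · exact absurd (by simpa using ht) (R.not_neg_mem α hα.1)
      by_cases hφα : φ = α
      · refine ⟨hφα, ?_⟩
        have : ψ = (n : ℝ) • α := by
          rw [hφα] at h
          rw [← sub_eq_zero] at h ⊢
          rw [← h]; push_cast; module
        rw [this]; exact hmult _ (this ▸ hψ)
      · have h1 := sub_pos_of_simple hα hφ
          (sub_mem_of_inner_pos (R.pos_subset hφ) hαΔ hpos hφα)
        have h2 := (ih _ h1 ψ hψ (by
          rw [← sub_eq_zero] at h ⊢
          rw [← h]; push_cast; module)).1
        have h3 : φ = (2 : ℝ) • α := by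
          rw [two_smul]; exact sub_eq_iff_eq_add.1 h2
        exact absurd (h3.trans (hmult _ (h3 ▸ hφ))) hφα
    intro φ hφ ψ hψ h
    have hs : 0 < ⟪φ, α⟫_ℝ + ⟪ψ, α⟫_ℝ := by
      rw [← inner_add_left, h, real_inner_smul_left]; positivity
    by_cases hp : 0 < ⟪φ, α⟫_ℝ
    · exact key φ hφ ψ hψ h hp
    · exact (key ψ hψ φ hφ (by rw [add_comm, h]) (by linarith)).symm

/-- A simple reflection permutes the other positive roots. -/
lemma reflectRoot_simple_pos {α φ : V} (hα : α ∈ R.Simple) (hφ : φ ∈ R.Pos) (hne : φ ≠ α) :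
    reflectRoot α φ ∈ R.Pos := by
  have hαΔ := R.pos_subset hα.1
  have ha := inner_self_pos_of_mem hαΔ
  obtain ⟨n, hn, hmem⟩ := exists_reflect (R.pos_subset hφ) hαΔ
  have e : reflectRoot α φ = φ - (n : ℝ) • α := by
    rw [reflectRoot, hn, mul_div_cancel_right₀ _ ha.ne']
  rw [e]
  rcases pos_or_neg_pos hmem with h | h
  · exact h
  exfalso
  rcases le_or_gt n 0 with h0 | h0
  · obtain ⟨k, rfl⟩ : ∃ k : ℕ, n = -k := ⟨n.natAbs, by omega⟩
    refine multiset_sum_ne_zero (R := R)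
      (φ ::ₘ (-(φ - ((-(k : ℤ) : ℤ) : ℝ) • α)) ::ₘ Multiset.replicate k α) ?_ (by simp) ?_
    · intro x hx
      rcases Multiset.mem_cons.1 hx with rfl | hx
      · exact hφ
      rcases Multiset.mem_cons.1 hx with rfl | hx
      · exact h
      · rw [Multiset.eq_of_mem_replicate hx]; exact hα.1
    · simp only [Multiset.sum_cons, Multiset.sum_replicate, ← Nat.cast_smul_eq_nsmul ℝ]
      push_cast; module
  · obtain ⟨k, rfl⟩ : ∃ k : ℕ, n = k := ⟨n.toNat, by omega⟩
    exact hne (eq_simple_of_add_eq_smul hα k φ hφ _ h (by push_cast; module)).1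

lemma inner_reflectRoot {α φ : V} (hα : α ≠ 0) : ⟪reflectRoot α φ, α⟫_ℝ = -⟪φ, α⟫_ℝ := by
  have : ⟪α, α⟫_ℝ ≠ 0 := (real_inner_self_pos.2 hα).ne'
  rw [reflectRoot, inner_sub_left, real_inner_smul_left, div_mul_cancel₀ _ this]; ring

lemma reflectRoot_reflectRoot {α φ : V} (hα : α ≠ 0) : reflectRoot α (reflectRoot α φ) = φ := by
  rw [reflectRoot, inner_reflectRoot hα, reflectRoot, mul_neg, neg_div, neg_smul]; abel

variable (R) in
/-- There is a vector having positive inner product with every positive root. -/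
lemma exists_inner_pos : ∃ v : V, ∀ α ∈ R.Pos, 0 < ⟪v, α⟫_ℝ := by
  classical
  have hf : R.Pos.Finite := R.finite.subset R.pos_subset
  refine ⟨∑ φ ∈ hf.toFinset, φ, pos_induction ?_ ?_⟩
  · intro α hα
    have hα0 := ne_zero_of_mem (R.pos_subset hα.1)
    rw [sum_inner, ← Finset.add_sum_erase _ _ (hf.mem_toFinset.2 hα.1)]
    have hmaps : ∀ φ ∈ hf.toFinset.erase α, reflectRoot α φ ∈ hf.toFinset.erase α := by
      intro φ hφ
      simp only [Finset.mem_erase, Set.Finite.mem_toFinset] at hφ ⊢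
      refine ⟨fun h => ?_, reflectRoot_simple_pos hα hφ.2 hφ.1⟩
      have h1 := reflectRoot_reflectRoot (φ := φ) hα0
      have h2 : reflectRoot α α = -α := by
        rw [reflectRoot, mul_div_assoc, div_self (real_inner_self_pos.2 hα0).ne']; module
      rw [h, h2] at h1
      exact R.not_neg_mem α hα.1 (h1 ▸ hφ.2)
    have h0 : ∑ φ ∈ hf.toFinset.erase α, ⟪φ, α⟫_ℝ =
        ∑ φ ∈ hf.toFinset.erase α, -⟪φ, α⟫_ℝ :=
      Finset.sum_nbij' (reflectRoot α) (reflectRoot α) hmaps hmaps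
        (fun φ _ => reflectRoot_reflectRoot hα0) (fun φ _ => reflectRoot_reflectRoot hα0)
        (fun φ _ => by rw [inner_reflectRoot hα0, neg_neg])
    rw [Finset.sum_neg_distrib] at h0
    linarith [real_inner_self_pos.2 hα0]
  · intro β _ γ _ h1 h2
    rw [inner_add_right]; exact add_pos h1 h2

lemma inner_simple_nonpos {α α' : V} (hα : α ∈ R.Simple) (hα' : α' ∈ R.Simple) (hne : α ≠ α') :
    ⟪α, α'⟫_ℝ ≤ 0 := by
  by_contra! h
  have h1 := sub_mem_of_inner_pos (R.pos_subset hα.1) (R.pos_subset hα'.1) h hne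
  have h2 := sub_pos_of_simple hα' hα.1 h1
  exact hα.2 ⟨_, h2, α', hα'.1, by abel⟩

variable (R) in
lemma simple_linearIndependent : LinearIndependent ℝ ((↑) : R.Simple → V) := by
  obtain ⟨v, hv⟩ := R.exists_inner_pos
  refine LinearMap.BilinForm.linearIndependent_of_pairwise_le_zero (innerₗ V) ?_ (innerₗ V v) _
    (fun α => hv _ α.2.1) fun α α' hne => ?_
  · exact fun x hx => real_inner_self_pos.2 hx
  · exact inner_simple_nonpos α.2 α'.2 (fun h => hne (Subtype.ext h))

variable (R) in
lemma span_simple : Submodule.span ℝ R.Simple = ⊤ := by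
  have h : ∀ β ∈ R.Pos, β ∈ Submodule.span ℝ R.Simple :=
    pos_induction (fun α hα => Submodule.subset_span hα)
      fun β _ γ _ h1 h2 => Submodule.add_mem _ h1 h2
  rw [eq_top_iff, ← R.span_top, Submodule.span_le]
  intro α hα
  rcases pos_or_neg_pos hα with hp | hp
  · exact h _ hp
  · simpa using h _ hp

variable (R) in
/-- The basis of simple roots. -/
noncomputable def simpleBasis : Module.Basis R.Simple ℝ V :=
  Module.Basis.mk R.simple_linearIndependent (by simp [R.span_simple])

@[simp] lemma simpleBasis_apply (α : R.Simple) : R.simpleBasis α = α := by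
  simp [simpleBasis]

lemma simpleBasis_repr_nonneg {β : V} (hβ : β ∈ R.Pos) (α : R.Simple) :
    0 ≤ R.simpleBasis.repr β α := by
  refine pos_induction (p := fun β => 0 ≤ R.simpleBasis.repr β α) ?_ ?_ β hβ
  · intro γ hγ
    have : R.simpleBasis.repr γ = Finsupp.single ⟨γ, hγ⟩ 1 := by
      simpa using R.simpleBasis.repr_self ⟨γ, hγ⟩
    rw [this]
    classical
    rw [Finsupp.single_apply]; split_ifs <;> simp
  · intro β _ γ _ h1 h2
    simpa using add_nonneg h1 h2

lemma NonnegComb.map_nonneg {x : V} (hx : R.NonnegComb x) (f : V →ₗ[ℝ] ℝ)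
    (hf : ∀ α ∈ R.Pos, 0 ≤ f α) : 0 ≤ f x := by
  obtain ⟨c, hc, rfl⟩ := hx
  rw [Finsupp.sum, map_sum]
  refine Finset.sum_nonneg fun α hα => ?_
  rw [map_smul, smul_eq_mul]
  exact mul_nonneg (Nat.cast_nonneg _) (hf α (hc hα))

lemma not_nonnegComb_neg {ψ : V} (hψ : ψ ∈ R.Pos) : ¬ R.NonnegComb (-ψ) := by
  intro h
  obtain ⟨v, hv⟩ := R.exists_inner_pos
  have := h.map_nonneg (innerₗ V v) (fun α hα => (hv α hα).le)
  simp only [innerₗ_apply_apply, inner_neg_right] at this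
  linarith [hv ψ hψ]

lemma mem_support_iff {φ : V} (α : R.Simple) :
    (α : V) ∈ R.support φ ↔ R.simpleBasis.repr φ α ≠ 0 := by
  have e : R.Simple \ {(α : V)} = R.simpleBasis '' {α}ᶜ := by
    ext x
    simp only [Set.mem_sdiff, Set.mem_singleton_iff, Set.mem_image, Set.mem_compl_iff,
      simpleBasis_apply]
    constructor
    · rintro ⟨h1, h2⟩
      exact ⟨⟨x, h1⟩, fun h => h2 (congrArg Subtype.val h), rfl⟩
    · rintro ⟨y, h1, rfl⟩
      exact ⟨y.2, fun h => h1 (Subtype.ext h)⟩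
  rw [support, Set.mem_ofPred_eq, e, Module.Basis.mem_span_image, Set.subset_compl_singleton_iff,
    not_not]
  simp

lemma support_eq_image (φ : V) :
    R.support φ = R.simpleBasis '' (R.simpleBasis.repr φ).support := by
  ext x
  constructor
  · intro h
    exact ⟨⟨x, h.1⟩, by simpa using (mem_support_iff ⟨x, h.1⟩).1 h, by simp⟩
  · rintro ⟨α, h, rfl⟩
    rw [simpleBasis_apply, mem_support_iff]
    simpa using h

lemma mem_span_support_iff {φ ψ : V} : ψ ∈ Submodule.span ℝ (R.support φ) ↔
    ∀ α, R.simpleBasis.repr φ α = 0 → R.simpleBasis.repr ψ α = 0 := by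
  rw [support_eq_image, Module.Basis.mem_span_image]
  simp only [Set.subset_def, Finset.mem_coe, Finsupp.mem_support_iff]
  exact forall_congr' fun α => not_imp_not

lemma mem_span_support (φ : V) : φ ∈ Submodule.span ℝ (R.support φ) :=
  mem_span_support_iff.2 fun _ h => h

end Basics

end RootSystemData

namespace RootSystemData

variable {V : Type*} [NormedAddCommGroup V] [InnerProductSpace ℝ V] (R : RootSystemData V)

/-- A chain cascade starting from the set of roots `S`, possibly empty. -/
def ChainFrom : Set V → List V → Prop
  | _, [] => True
  | S, β :: t => ∃ C, IsComponent S C ∧ R.IsHighest C β ∧ ChainFrom (R.orth β) t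

/-- `S` is the set of all roots in the span of the simple roots it contains. -/
def IsStandard (S : Set V) : Prop :=
  ∀ χ, χ ∈ S ↔ χ ∈ R.Δ ∧ χ ∈ Submodule.span ℝ (S ∩ R.Simple)

/-- Each entry `β` of the list lies in `W`, and adding `β` to a positive root in `W` never gives
a root, where `W` shrinks to the orthogonal complement of the entries already visited. -/
def Dominant : Submodule ℝ V → List V → Prop
  | _, [] => True
  | W, β :: t => β ∈ W ∧ β ∈ R.Pos ∧ (∀ ψ ∈ R.Pos, ψ ∈ W → β + ψ ∉ R.Δ) ∧
      Dominant (W ⊓ (Submodule.span ℝ {β})ᗮ) t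

variable {R}

lemma ChainFrom.of_chain {β : V} {l : List V}
    (h : (β :: l).Chain' fun γ δ => ∃ C, IsComponent (R.orth γ) C ∧ R.IsHighest C δ) :
    R.ChainFrom (R.orth β) l := by
  induction l generalizing β with
  | nil => trivial
  | cons γ t ih =>
    obtain ⟨⟨C, h1, h2⟩, h3⟩ := List.isChain_cons_cons.1 h
    exact ⟨C, h1, h2, ih h3⟩

lemma IsChainCascade.chainFrom {l : List V} (h : R.IsChainCascade l) : R.ChainFrom R.Δ l := by
  obtain ⟨h0, h1, h2⟩ := h
  cases l with
  | nil => trivial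
  | cons β t =>
    obtain ⟨C, hC, hβ⟩ := h1 β (by simp)
    exact ⟨C, hC, hβ, ChainFrom.of_chain h2⟩

variable (R) in
lemma isStandard_roots : R.IsStandard R.Δ := by
  intro χ
  have : R.Δ ∩ R.Simple = R.Simple :=
    Set.inter_eq_right.2 fun α hα => R.pos_subset hα.1
  rw [this, R.span_simple]; simp

lemma IsStandard.subset {S : Set V} (hS : R.IsStandard S) : S ⊆ R.Δ := fun χ h => ((hS χ).1 h).1

lemma IsStandard.neg_mem {S : Set V} (hS : R.IsStandard S) {χ : V} (h : χ ∈ S) : -χ ∈ S := by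
  rw [hS] at h ⊢
  exact ⟨R.neg_mem _ h.1, Submodule.neg_mem _ h.2⟩

/-- A vector orthogonal to a set is orthogonal to its span. -/
lemma inner_eq_zero_of_mem_span {T : Set V} {x y : V} (h : ∀ t ∈ T, ⟪x, t⟫_ℝ = 0)
    (hy : y ∈ Submodule.span ℝ T) : ⟪x, y⟫_ℝ = 0 := by
  induction hy using Submodule.span_induction with
  | mem t ht => exact h t ht
  | zero => simp
  | add a b _ _ ha hb => rw [inner_add_right, ha, hb, add_zero]
  | smul c a _ ha => rw [real_inner_smul_right, ha, mul_zero]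

section Component

variable {S C : Set V} {β : V}

lemma support_subset_component (hS : R.IsStandard S) (hC : IsComponent S C) (hβ : β ∈ C) :
    R.support β ⊆ C := by
  have h1 : β ∈ Submodule.span ℝ (C ∩ R.Simple) := by
    have h2 := ((hS β).1 (hC.1 hβ)).2
    have e : S ∩ R.Simple = (C ∩ R.Simple) ∪ ((S \ C) ∩ R.Simple) := by
      rw [← Set.union_inter_distrib_right, Set.union_sdiff_cancel hC.1]
    rw [e, Submodule.span_union, Submodule.mem_sup] at h2
    obtain ⟨x, hx, y, hy, hxy⟩ := h2
    have hyC : ∀ c ∈ C, ⟪c, y⟫_ℝ = 0 := fun c hc =>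
      inner_eq_zero_of_mem_span (fun t ht => hC.2.2 c hc t ht.1) hy
    have hyx : ⟪y, x⟫_ℝ = 0 :=
      inner_eq_zero_of_mem_span (fun t ht => by rw [real_inner_comm]; exact hyC t ht.1) hx
    have hyβ := hyC β hβ
    rw [← hxy, inner_add_left, real_inner_comm, hyx, zero_add, inner_self_eq_zero] at hyβ
    rw [← hxy, hyβ, add_zero]
    exact hx
  intro α hα
  by_contra hαC
  refine hα.2 (Submodule.span_mono ?_ h1)
  rintro x ⟨hx, hx'⟩
  exact ⟨hx', fun h => hαC (h ▸ hx)⟩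

lemma sub_eq_component (hS : R.IsStandard S) (hC : IsComponent S C) (hβ : R.IsHighest C β) :
    R.sub β = C := by
  have hsupp := support_subset_component hS hC hβ.1
  apply Set.Subset.antisymm
  · rintro ψ ⟨hψ, hspan⟩
    have hle : R.support β ⊆ S ∩ R.Simple := fun α hα => ⟨hC.1 (hsupp hα), hα.1⟩
    have hψS : ψ ∈ S := (hS ψ).2 ⟨hψ, Submodule.span_mono hle hspan⟩
    by_contra hψC
    refine ne_zero_of_mem hψ (inner_self_eq_zero (𝕜 := ℝ).1 ?_)
    refine inner_eq_zero_of_mem_span (fun t ht => ?_) hspan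
    rw [real_inner_comm]
    exact hC.2.2 t (hsupp ht) ψ ⟨hψS, hψC⟩
  · intro ψ hψ
    have hψΔ := hS.subset (hC.1 hψ)
    have hneg : -ψ ∈ C := by
      by_contra h
      have := hC.2.2 ψ hψ (-ψ) ⟨hS.neg_mem (hC.1 hψ), h⟩
      rw [inner_neg_right, neg_eq_zero, inner_self_eq_zero] at this
      exact ne_zero_of_mem hψΔ this
    refine ⟨hψΔ, mem_span_support_iff.2 fun α hα => ?_⟩
    have key : ∀ χ ∈ C, 0 ≤ R.simpleBasis.repr (β - χ) α := fun χ hχ =>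
      (hβ.2.2 χ hχ).map_nonneg (R.simpleBasis.coord α) fun γ hγ => simpleBasis_repr_nonneg hγ α
    have h1 := key ψ hψ
    have h2 := key _ hneg
    simp only [map_sub, map_neg, Finsupp.coe_sub, Finsupp.coe_neg, Pi.sub_apply, Pi.neg_apply,
      hα] at h1 h2
    linarith

lemma add_notMem_of_mem_component (hS : R.IsStandard S) (hC : IsComponent S C)
    (hβ : R.IsHighest C β) {ψ : V} (hψ : ψ ∈ R.Pos) (hψC : ψ ∈ C) : β + ψ ∉ R.Δ := by
  intro h
  have hsub := sub_eq_component hS hC hβ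
  have h1 : β + ψ ∈ C := by
    rw [← hsub] at hψC ⊢
    exact ⟨h, Submodule.add_mem _ (mem_span_support β) hψC.2⟩
  refine not_nonnegComb_neg hψ ?_
  simpa using hβ.2.2 _ h1

lemma inner_nonneg_of_add_notMem {ψ : V} (hβ : β ∈ R.Pos) (hψ : ψ ∈ R.Pos)
    (h : β + ψ ∉ R.Δ) : 0 ≤ ⟪ψ, β⟫_ℝ := by
  by_contra! hneg
  rw [add_comm] at h
  refine h (add_mem_of_inner_neg (R.pos_subset hψ) (R.pos_subset hβ) hneg fun e => ?_)
  exact R.not_neg_mem β hβ (e ▸ hψ)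

lemma isStandard_orth (hS : R.IsStandard S) (hC : IsComponent S C) (hβ : R.IsHighest C β) :
    R.IsStandard (R.orth β) := by
  have hsub := sub_eq_component hS hC hβ
  have hsupp : ∀ α ∈ R.support β, 0 ≤ ⟪α, β⟫_ℝ := fun α hα =>
    inner_nonneg_of_add_notMem hβ.2.1 hα.1.1 (add_notMem_of_mem_component hS hC hβ hα.1.1
      (support_subset_component hS hC hβ.1 hα))
  have hpos : ∀ χ ∈ R.Pos, χ ∈ R.orth β → χ ∈ Submodule.span ℝ (R.orth β ∩ R.Simple) := by
    rintro χ hχ ⟨⟨hχΔ, hspan⟩, h0⟩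
    rw [mem_span_support_iff] at hspan
    have hrepr := R.simpleBasis.linearCombination_repr χ
    rw [Finsupp.linearCombination_apply, Finsupp.sum] at hrepr
    have hmem : ∀ α ∈ (R.simpleBasis.repr χ).support, (α : V) ∈ R.support β := fun α hα =>
      (mem_support_iff α).2 fun h => Finsupp.mem_support_iff.1 hα (hspan α h)
    have hsum : ∑ α ∈ (R.simpleBasis.repr χ).support,
        R.simpleBasis.repr χ α * ⟪(α : V), β⟫_ℝ = 0 := by
      rw [← h0]
      conv_rhs => rw [← hrepr, sum_inner]
      refine Finset.sum_congr rfl fun α _ => ?_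
      rw [real_inner_smul_left, simpleBasis_apply]
    rw [Finset.sum_eq_zero_iff_of_nonneg fun α hα =>
      mul_nonneg (simpleBasis_repr_nonneg hχ α) (hsupp α (hmem α hα))] at hsum
    rw [← hrepr]
    refine Submodule.sum_mem _ fun α hα => Submodule.smul_mem _ _ (Submodule.subset_span ?_)
    rw [simpleBasis_apply]
    refine ⟨⟨⟨R.pos_subset α.2.1, Submodule.subset_span (hmem α hα)⟩, ?_⟩, α.2⟩
    exact (mul_eq_zero.1 (hsum α hα)).resolve_left (Finsupp.mem_support_iff.1 hα)
  intro χ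
  constructor
  · intro hχ
    refine ⟨hχ.1.1, ?_⟩
    rcases pos_or_neg_pos hχ.1.1 with h | h
    · exact hpos χ h hχ
    · rw [← Submodule.neg_mem_iff]
      exact hpos _ h ⟨⟨R.neg_mem _ hχ.1.1, Submodule.neg_mem _ hχ.1.2⟩, by simp [hχ.2]⟩
  · rintro ⟨hχ, hspan⟩
    refine ⟨⟨hχ, ?_⟩, ?_⟩
    · exact Submodule.span_le.2 (fun α hα => hα.1.1.2) hspan
    · rw [real_inner_comm]
      exact inner_eq_zero_of_mem_span (fun t ht => by rw [real_inner_comm]; exact ht.1.2) hspan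

lemma orth_subset_component (hS : R.IsStandard S) (hC : IsComponent S C)
    (hβ : R.IsHighest C β) : R.orth β ⊆ C := fun _ hχ => sub_eq_component hS hC hβ ▸ hχ.1

end Component

lemma ChainFrom.subset {S : Set V} {l : List V} (hS : R.IsStandard S) (h : R.ChainFrom S l) :
    ∀ b ∈ l, b ∈ S ∧ b ∈ R.Pos := by
  induction l generalizing S with
  | nil => simp
  | cons β t ih =>
    obtain ⟨C, hC, hβ, ht⟩ := h
    intro b hb
    rcases List.mem_cons.1 hb with rfl | hb
    · exact ⟨hC.1 hβ.1, hβ.2.1⟩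
    · have := ih (isStandard_orth hS hC hβ) ht b hb
      exact ⟨hC.1 (orth_subset_component hS hC hβ this.1), this.2⟩

lemma ChainFrom.dominant {S : Set V} {l : List V} (hS : R.IsStandard S) (h : R.ChainFrom S l)
    (W : Submodule ℝ V) (hSW : ∀ χ ∈ S, χ ∈ W)
    (hW : ∀ χ ∈ R.Δ, χ ∈ W → χ ∈ S ∨ ∀ s ∈ S, ⟪χ, s⟫_ℝ = 0) : R.Dominant W l := by
  induction l generalizing S W with
  | nil => trivial
  | cons β t ih =>
    obtain ⟨C, hC, hβ, ht⟩ := h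
    have hsub := sub_eq_component hS hC hβ
    have hβΔ := R.pos_subset hβ.2.1
    have hWC : ∀ χ ∈ R.Δ, χ ∈ W → χ ∈ C ∨ ∀ c ∈ C, ⟪χ, c⟫_ℝ = 0 := by
      intro χ hχ hχW
      by_cases hχC : χ ∈ C
      · exact Or.inl hχC
      refine Or.inr fun c hc => ?_
      rcases hW χ hχ hχW with h | h
      · rw [real_inner_comm]; exact hC.2.2 c hc χ ⟨h, hχC⟩
      · exact h c (hC.1 hc)
    have hβW : β ∈ W := hSW β (hC.1 hβ.1)
    refine ⟨hβW, hβ.2.1, ?_, ?_⟩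
    · intro ψ hψ hψW hadd
      rcases hWC ψ (R.pos_subset hψ) hψW with h | h
      · exact add_notMem_of_mem_component hS hC hβ hψ h hadd
      rcases hWC _ hadd (W.add_mem hβW hψW) with h' | h'
      · have h1 := h _ h'
        rw [inner_add_right, h β hβ.1, zero_add, inner_self_eq_zero] at h1
        exact ne_zero_of_mem (R.pos_subset hψ) h1
      · have h1 := h' β hβ.1
        rw [inner_add_left, h β hβ.1, add_zero, inner_self_eq_zero] at h1
        exact ne_zero_of_mem hβΔ h1
    · refine ih (isStandard_orth hS hC hβ) ht _ (fun χ hχ => ⟨?_, ?_⟩) ?_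
      · exact hSW χ (hC.1 (orth_subset_component hS hC hβ hχ))
      · exact Submodule.mem_orthogonal_singleton_iff_inner_left.2 hχ.2
      · rintro χ hχ ⟨hχW, hχβ⟩
        have hχβ' := Submodule.mem_orthogonal_singleton_iff_inner_left.1 hχβ
        rcases hWC χ hχ hχW with h | h
        · exact Or.inl ⟨hsub ▸ h, hχβ'⟩
        · exact Or.inr fun s hs => h s (orth_subset_component hS hC hβ hs)

/-- Distinct irreducible components are orthogonal. -/
lemma component_eq_or_orthogonal {S C C' : Set V} (hC : IsComponent S C)
    (hC' : IsComponent S C') : C = C' ∨ ∀ a ∈ C, ∀ b ∈ C', ⟪a, b⟫_ℝ = 0 := by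
  by_cases h : (C ∩ C').Nonempty
  · left
    have key : ∀ {A B : Set V}, IsComponent S A → IsComponent S B → (A ∩ B).Nonempty → A ⊆ B := by
      intro A B hA hB hne
      by_contra hsub
      exact hA.2.1.2 ⟨A ∩ B, A \ B, Set.inter_union_sdiff A B, Set.ext (by simp +contextual),
        hne, Set.sdiff_nonempty.2 hsub, fun a ha b hb => hB.2.2 a ha.2 b ⟨hA.1 hb.1, hb.2⟩⟩
    exact (key hC hC' h).antisymm (key hC' hC (by rwa [Set.inter_comm]))
  · right
    intro a ha b hb
    exact hC.2.2 a ha b ⟨hC'.1 hb, fun hb' => h ⟨b, hb', hb⟩⟩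

lemma IsHighest.unique {C : Set V} {β β' : V} (h : R.IsHighest C β) (h' : R.IsHighest C β') :
    β = β' := by
  refine R.simpleBasis.ext_elem fun α => ?_
  have key : ∀ {γ γ'}, R.IsHighest C γ → R.IsHighest C γ' →
      R.simpleBasis.repr γ α ≤ R.simpleBasis.repr γ' α := by
    intro γ γ' hγ hγ'
    have := (hγ'.2.2 γ hγ.1).map_nonneg (R.simpleBasis.coord α)
      fun δ hδ => simpleBasis_repr_nonneg hδ α
    simpa using this
  exact (key h h').antisymm (key h' h)

lemma ChainFrom.orthogonal {S : Set V} {l l' : List V} (hS : R.IsStandard S)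
    (h : R.ChainFrom S l) (h' : R.ChainFrom S l') :
    ∀ b ∈ l, ∀ b' ∈ l', b ≠ b' → ⟪b, b'⟫_ℝ = 0 := by
  induction l generalizing S l' with
  | nil => simp
  | cons β t ih =>
    cases l' with
    | nil => simp
    | cons β' t' =>
      obtain ⟨C, hC, hβ, ht⟩ := h
      obtain ⟨C', hC', hβ', ht'⟩ := h'
      have hO := isStandard_orth hS hC hβ
      intro b hb b' hb' hne
      rcases component_eq_or_orthogonal hC hC' with rfl | hperp
      · obtain rfl := hβ.unique hβ'
        rcases List.mem_cons.1 hb with hb1 | hb1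
        · rcases List.mem_cons.1 hb' with hb2 | hb2
          · exact absurd (hb1.trans hb2.symm) hne
          · rw [hb1, real_inner_comm]; exact (ht'.subset hO b' hb2).1.2
        · rcases List.mem_cons.1 hb' with hb2 | hb2
          · rw [hb2]; exact (ht.subset hO b hb1).1.2
          · exact ih hO ht ht' b hb1 b' hb2 hne
      · refine hperp b ?_ b' ?_
        · rcases List.mem_cons.1 hb with rfl | hb
          · exact hβ.1
          · exact orth_subset_component hS hC hβ (ht.subset hO b hb).1
        · have hO' := isStandard_orth hS hC' hβ'
          rcases List.mem_cons.1 hb' with rfl | hb'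
          · exact hβ'.1
          · exact orth_subset_component hS hC' hβ' (ht'.subset hO' b' hb').1

lemma cascade_subset_pos : R.cascade ⊆ R.Pos := by
  rintro β ⟨l, hl, hβ⟩
  exact (hl.chainFrom.subset R.isStandard_roots β hβ).2

lemma cascade_orthogonal {β β' : V} (hβ : β ∈ R.cascade) (hβ' : β' ∈ R.cascade) (hne : β ≠ β') :
    ⟪β, β'⟫_ℝ = 0 := by
  obtain ⟨l, hl, h⟩ := hβ
  obtain ⟨l', hl', h'⟩ := hβ'
  exact hl.chainFrom.orthogonal R.isStandard_roots hl'.chainFrom β h β' h' hne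

lemma exists_dominant_of_mem_cascade {β : V} (hβ : β ∈ R.cascade) :
    ∃ l, β ∈ l ∧ (∀ b ∈ l, b ∈ R.cascade) ∧ R.Dominant ⊤ l := by
  obtain ⟨l, hl, h⟩ := hβ
  exact ⟨l, h, fun b hb => ⟨l, hl, hb⟩, hl.chainFrom.dominant R.isStandard_roots ⊤
    (fun _ _ => trivial) fun χ hχ _ => Or.inl hχ⟩

end RootSystemData

section ExpNil

variable {L : Type*} [AddCommGroup L] [Module ℂ L]

lemma expNil_eq_of_le {f : Module.End ℂ L} {M N : ℕ} (hM : f ^ M = 0) (h : M ≤ N) :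
    expNil f N = expNil f M := by
  refine (Finset.sum_subset (Finset.range_mono h) fun i _ hi => ?_).symm
  rw [pow_eq_zero_of_le (by simpa using hi) hM, smul_zero]

/-- The truncated exponential does not depend on the truncation. -/
lemma expNil_eq {f : Module.End ℂ L} {M N : ℕ} (hM : f ^ M = 0) (hN : f ^ N = 0) :
    expNil f M = expNil f N := by
  rcases le_total M N with h | h
  · exact (expNil_eq_of_le hM h).symm
  · exact expNil_eq_of_le hN h

lemma expNil_apply (f : Module.End ℂ L) (N : ℕ) (x : L) :
    expNil f N x = ∑ i ∈ Finset.range N, ((i.factorial : ℂ))⁻¹ • (f ^ i) x := by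
  simp [expNil]

lemma pow_apply_mem {f : Module.End ℂ L} {U : Submodule ℂ L} (hU : ∀ u ∈ U, f u ∈ U) {x : L}
    (hx : x ∈ U) (i : ℕ) : (f ^ i) x ∈ U := by
  induction i with
  | zero => simpa
  | succ i ih => rw [pow_succ']; exact hU _ ih

lemma expNil_apply_mem {f : Module.End ℂ L} {U : Submodule ℂ L} (hU : ∀ u ∈ U, f u ∈ U) {x : L}
    (hx : x ∈ U) (N : ℕ) : expNil f N x ∈ U := by
  rw [expNil_apply]
  exact Submodule.sum_mem _ fun i _ => U.smul_mem _ (pow_apply_mem hU hx i)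

lemma expNil_apply_sub_mem {f : Module.End ℂ L} {U : Submodule ℂ L} (hU : ∀ u ∈ U, f u ∈ U)
    {x : L} (hx : f x ∈ U) (N : ℕ) : expNil f (N + 1) x - x ∈ U := by
  rw [expNil_apply, Finset.sum_range_succ']
  simp only [Nat.factorial_zero, Nat.cast_one, inv_one, pow_zero, Module.End.one_apply, one_smul,
    add_sub_cancel_right]
  refine Submodule.sum_mem _ fun i _ => U.smul_mem _ ?_
  rw [pow_succ]
  exact pow_apply_mem hU hx i

lemma expNil_apply_eq_self {f : Module.End ℂ L} {x : L} (hx : f x = 0) (N : ℕ) :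
    expNil f (N + 1) x = x := by
  have := expNil_apply_sub_mem (U := ⊥) (f := f) (x := x) (by simp) (by simpa using hx) N
  rwa [Submodule.mem_bot, sub_eq_zero] at this

/-- Perturbing an endomorphism preserving `P` by one mapping `P` to `F` changes the exponential
on `P` only by elements of `F`. -/
lemma expNil_add_apply_sub_mem {f g : Module.End ℂ L} {P F : Submodule ℂ L}
    (hfP : ∀ p ∈ P, f p ∈ P) (hgP : ∀ p ∈ P, g p ∈ F) (hF : ∀ p ∈ F, (f + g) p ∈ F)
    {p : L} (hp : p ∈ P) (N : ℕ) : expNil (f + g) N p - expNil f N p ∈ F := by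
  rw [expNil_apply, expNil_apply, ← Finset.sum_sub_distrib]
  refine Submodule.sum_mem _ fun i hi => ?_
  rw [← smul_sub]
  refine F.smul_mem _ ?_
  clear hi
  induction i with
  | zero => simp
  | succ i ih =>
    have e : ((f + g) ^ (i + 1)) p - (f ^ (i + 1)) p =
        (f + g) (((f + g) ^ i) p - (f ^ i) p) + g ((f ^ i) p) := by
      rw [pow_succ', pow_succ', map_sub]
      simp only [Module.End.mul_apply, LinearMap.add_apply]
      abel
    rw [e]
    exact F.add_mem (hF _ ih) (hgP _ (pow_apply_mem hfP hp i))

end ExpNil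

/-- The exponential of a nilpotent inner derivation is multiplicative. -/
lemma expNil_ad_lie {L : Type*} [LieRing L] [LieAlgebra ℂ L] {z : L} {N : ℕ}
    (hz : (LieAlgebra.ad ℂ L z) ^ N = 0) (x y : L) :
    expNil (LieAlgebra.ad ℂ L z) N ⁅x, y⁆ =
      ⁅expNil (LieAlgebra.ad ℂ L z) N x, expNil (LieAlgebra.ad ℂ L z) N y⁆ := by
  let _ : Module ℚ L := Module.compHom L (algebraMap ℚ ℂ)
  have hsmul : ∀ (q : ℚ) (x : L), q • x = (q : ℂ) • x := fun q x => rfl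
  let _ : LieAlgebra ℚ L := { lie_smul := fun q x y => by simp only [hsmul, lie_smul] }
  have had : (LieDerivation.ad ℂ L z).toLinearMap = LieAlgebra.ad ℂ L z :=
    LieDerivation.coe_ad_apply_eq_ad_apply z
  have hnil : IsNilpotent (LieDerivation.ad ℂ L z).toLinearMap := ⟨N, by rw [had, hz]⟩
  have key : expNil (LieAlgebra.ad ℂ L z) N =
      IsNilpotent.exp (LieDerivation.ad ℂ L z).toLinearMap := by
    rw [had, IsNilpotent.exp_eq_sum (k := N) hz, expNil]
    refine Finset.sum_congr rfl fun i _ => LinearMap.ext fun w => ?_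
    rw [LinearMap.smul_apply, LinearMap.smul_apply, hsmul]
    push_cast
    rfl
  rw [key]
  exact LieHom.map_lie (LieDerivation.exp _ hnil).toLieHom x y

/-- A bracket of spans is contained in any subspace containing the brackets of generators. -/
lemma lie_mem_of_mem_span {L : Type*} [LieRing L] [LieAlgebra ℂ L] {S T : Set L}
    {U : Submodule ℂ L} (h : ∀ s ∈ S, ∀ t ∈ T, ⁅s, t⁆ ∈ U) {x y : L}
    (hx : x ∈ Submodule.span ℂ S) (hy : y ∈ Submodule.span ℂ T) : ⁅x, y⁆ ∈ U := by
  induction hx, hy using Submodule.span_induction₂ with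
  | mem_mem s t hs ht => exact h s hs t ht
  | zero_left => simp
  | zero_right => simp
  | add_left a b c _ _ _ h1 h2 => rw [add_lie]; exact U.add_mem h1 h2
  | add_right a b c _ _ _ h1 h2 => rw [lie_add]; exact U.add_mem h1 h2
  | smul_left r a b _ _ h => rw [smul_lie]; exact U.smul_mem _ h
  | smul_right r a b _ _ h => rw [lie_smul]; exact U.smul_mem _ h

namespace CascadeLieData

variable {V : Type*} [NormedAddCommGroup V] [InnerProductSpace ℝ V]
  {L : Type*} [LieRing L] [LieAlgebra ℂ L]
  (C : CascadeLieData V L)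

/-- The part of the Lie algebra of height at least `t`, where `v` defines the height. -/
def heightGE (v : V) (t : ℝ) : Submodule ℂ L :=
  Submodule.span ℂ (C.e '' {χ ∈ C.Δ | t ≤ ⟪v, χ⟫_ℝ} ∪ {x | x ∈ C.H ∧ t ≤ 0})

variable {C}

lemma e_mem_heightGE {v : V} {t : ℝ} {χ : V} (hχ : χ ∈ C.Δ) (h : t ≤ ⟪v, χ⟫_ℝ) :
    C.e χ ∈ C.heightGE v t := Submodule.subset_span (Or.inl ⟨χ, ⟨hχ, h⟩, rfl⟩)

lemma lie_cartan (x : L) (hx : x ∈ C.H) {φ : V} (hφ : φ ∈ C.Δ) :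
    ⁅C.e φ, x⁆ = -C.wt φ ⟨x, hx⟩ • C.e φ := by
  rw [← lie_skew, C.root_vec ⟨x, hx⟩ φ hφ, neg_smul]

lemma lie_mem_heightGE {v : V} {ε t : ℝ} (hv : ∀ α ∈ C.Pos, ε ≤ ⟪v, α⟫_ℝ) {z x : L}
    (hz : z ∈ C.nSub) (hx : x ∈ C.heightGE v t) : ⁅z, x⁆ ∈ C.heightGE v (t + ε) := by
  refine lie_mem_of_mem_span ?_ hz hx
  rintro _ ⟨φ, hφ, rfl⟩ y (⟨χ, ⟨hχ, ht⟩, rfl⟩ | ⟨hy, ht⟩)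
  · have hφΔ := C.pos_subset hφ
    have hh := hv φ hφ
    by_cases h0 : φ + χ = 0
    · obtain rfl : χ = -φ := (neg_eq_of_add_eq_zero_right h0).symm
      rw [inner_neg_right] at ht
      exact Submodule.subset_span (Or.inr ⟨C.bracket_opp φ hφΔ, by linarith⟩)
    by_cases hmem : φ + χ ∈ C.Δ
    · obtain ⟨c, -, hc⟩ := C.bracket_add φ hφΔ χ hχ hmem
      rw [hc]
      refine Submodule.smul_mem _ _ (e_mem_heightGE hmem ?_)
      rw [inner_add_right]; linarith
    · rw [C.bracket_zero φ hφΔ χ hχ hmem h0]; exact Submodule.zero_mem _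
  · rw [lie_cartan y hy (C.pos_subset hφ)]
    exact Submodule.smul_mem _ _ (e_mem_heightGE (C.pos_subset hφ) (by linarith [hv φ hφ]))

variable (C) in
/-- The elements of the nilradical are ad-nilpotent, with a uniform bound. -/
lemma exists_ad_pow_eq_zero : ∃ M : ℕ, ∀ z ∈ C.nSub, (LieAlgebra.ad ℂ L z) ^ M = 0 := by
  obtain ⟨v, hv⟩ := C.toRootSystemData.exists_inner_pos
  obtain ⟨ε, hε, hvε⟩ : ∃ ε : ℝ, 0 < ε ∧ ∀ α ∈ C.Pos, ε ≤ ⟪v, α⟫_ℝ := by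
    rcases C.Pos.eq_empty_or_nonempty with h | h
    · exact ⟨1, one_pos, by simp [h]⟩
    · obtain ⟨α, hα, hmin⟩ := Set.exists_min_image C.Pos (fun α => ⟪v, α⟫_ℝ)
        (C.finite.subset C.pos_subset) h
      exact ⟨_, hv α hα, hmin⟩
  obtain ⟨T, hT0, hT⟩ : ∃ T : ℝ, 0 < T ∧ ∀ χ ∈ C.Δ, |⟪v, χ⟫_ℝ| < T := by
    obtain ⟨T, hT⟩ := (C.finite.image fun χ => |⟪v, χ⟫_ℝ|).bddAbove
    refine ⟨|T| + 1, by positivity, fun χ hχ => ?_⟩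
    have := hT ⟨χ, hχ, rfl⟩
    simp only at this
    linarith [le_abs_self T]
  obtain ⟨M, hM⟩ := exists_nat_gt (2 * T / ε)
  rw [div_lt_iff₀ hε] at hM
  refine ⟨M, fun z hz => LinearMap.ext fun x => ?_⟩
  have htop : C.heightGE v (-T) = ⊤ := by
    rw [eq_top_iff, ← C.span_eq_top, sup_le_iff, Submodule.span_le]
    refine ⟨fun y hy => Submodule.subset_span (Or.inr ⟨hy, by linarith⟩), ?_⟩
    rintro _ ⟨χ, hχ, rfl⟩
    exact e_mem_heightGE hχ (abs_lt.1 (hT χ hχ)).1.le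
  have hstep : ∀ i : ℕ, (LieAlgebra.ad ℂ L z ^ i) x ∈ C.heightGE v (-T + i * ε) := by
    intro i
    induction i with
    | zero => simp [htop]
    | succ i ih =>
      rw [pow_succ']
      have := lie_mem_heightGE hvε hz ih
      push_cast
      rwa [show -T + (i + 1 : ℝ) * ε = -T + i * ε + ε by ring]
  have hbot : C.heightGE v (-T + M * ε) = ⊥ := by
    rw [heightGE, Submodule.span_eq_bot]
    rintro y (⟨χ, ⟨hχ, ht⟩, rfl⟩ | ⟨-, ht⟩)
    · linarith [(abs_lt.1 (hT χ hχ)).2]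
    · linarith
  have := hstep M
  rwa [hbot, Submodule.mem_bot] at this

end CascadeLieData

namespace RootSystemData

variable {V : Type*} [NormedAddCommGroup V] [InnerProductSpace ℝ V] {R : RootSystemData V}

variable (R) in
/-- `β` is a positive root in `W` to which no positive root in `W` can be added. -/
structure IsTopRoot (W : Submodule ℝ V) (β : V) : Prop where
  mem : β ∈ W
  pos : β ∈ R.Pos
  add_notMem : ∀ ψ ∈ R.Pos, ψ ∈ W → β + ψ ∉ R.Δ

namespace IsTopRoot

variable {W : Submodule ℝ V} {β χ : V} (D : R.IsTopRoot W β)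
include D

lemma root : β ∈ R.Δ := R.pos_subset D.pos

lemma inner_self_pos : 0 < ⟪β, β⟫_ℝ := inner_self_pos_of_mem D.root

lemma inner_nonneg (hχ : χ ∈ R.Pos) (hW : χ ∈ W) : 0 ≤ ⟪χ, β⟫_ℝ :=
  inner_nonneg_of_add_notMem D.pos hχ (D.add_notMem χ hχ hW)

lemma pos_of_inner_pos (hχ : χ ∈ R.Δ) (hW : χ ∈ W) (h : 0 < ⟪χ, β⟫_ℝ) : χ ∈ R.Pos := by
  refine (pos_or_neg_pos hχ).resolve_right fun hn => ?_
  have := D.inner_nonneg hn (W.neg_mem hW)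
  rw [inner_neg_left] at this
  linarith

lemma neg_pos_of_inner_neg (hχ : χ ∈ R.Δ) (hW : χ ∈ W) (h : ⟪χ, β⟫_ℝ < 0) : -χ ∈ R.Pos :=
  D.pos_of_inner_pos (R.neg_mem _ hχ) (W.neg_mem hW) (by rw [inner_neg_left]; linarith)

lemma add_notMem_of_orthogonal (hχ : χ ∈ R.Δ) (hW : χ ∈ W) (h : ⟪χ, β⟫_ℝ = 0) :
    χ + β ∉ R.Δ := by
  intro hadd
  rcases pos_or_neg_pos hχ with hp | hn
  · exact D.add_notMem χ hp hW (by rwa [add_comm])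
  · refine D.add_notMem _ hn (W.neg_mem hW) ?_
    rw [add_comm]
    refine add_mem_of_sub_mem D.root (by simp [h]) ?_
    rw [← neg_add']
    exact R.neg_mem _ hadd

lemma sub_notMem_of_orthogonal (hχ : χ ∈ R.Δ) (hW : χ ∈ W) (h : ⟪χ, β⟫_ℝ = 0) :
    χ + -β ∉ R.Δ := fun hsub => D.add_notMem_of_orthogonal hχ hW h
  (add_mem_of_sub_mem D.root h (by rwa [sub_eq_add_neg]))

lemma two_mul_inner (hχ : χ ∈ R.Δ) (hW : χ ∈ W) (h : 0 < ⟪χ, β⟫_ℝ) (hne : χ ≠ β) :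
    2 * ⟪χ, β⟫_ℝ = ⟪β, β⟫_ℝ := by
  have hb := D.inner_self_pos
  obtain ⟨n, hn, -⟩ := exists_reflect hχ D.root
  have hsub := sub_mem_of_inner_pos hχ D.root h hne
  have hsW := W.sub_mem hW D.mem
  have hin : ⟪χ - β, β⟫_ℝ < 0 := by
    by_contra! h0
    rcases h0.eq_or_lt with h0 | h0
    · exact D.add_notMem_of_orthogonal hsub hsW h0.symm (by simpa using hχ)
    · exact D.add_notMem _ (D.pos_of_inner_pos hsub hsW h0) hsW (by simpa using hχ)
  rw [inner_sub_left] at hin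
  have h1 : (0 : ℝ) < n := by
    by_contra! hc
    nlinarith
  have h2 : (n : ℝ) < 2 := by
    by_contra! hc
    nlinarith
  have h3 : n = 1 := by
    have : 0 < n := by exact_mod_cast h1
    have : n < 2 := by exact_mod_cast h2
    omega
  rw [hn, h3]; simp

lemma two_mul_inner_neg (hχ : χ ∈ R.Δ) (hW : χ ∈ W) (h : ⟪χ, β⟫_ℝ < 0) (hne : χ ≠ -β) :
    2 * ⟪χ, β⟫_ℝ = -⟪β, β⟫_ℝ := by
  have := D.two_mul_inner (R.neg_mem _ hχ) (W.neg_mem hW) (by rw [inner_neg_left]; linarith)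
    (fun h => hne (by rw [← h, neg_neg]))
  rw [inner_neg_left] at this
  linarith

end IsTopRoot

end RootSystemData

namespace CascadeLieData

open RootSystemData

variable {V : Type*} [NormedAddCommGroup V] [InnerProductSpace ℝ V]
  {L : Type*} [LieRing L] [LieAlgebra ℂ L] {C : CascadeLieData V L}

variable (C) in
/-- The span of the root vectors attached to a set of roots. -/
def rootSpan (S : Set V) : Submodule ℂ L := Submodule.span ℂ (C.e '' S)

lemma e_mem_rootSpan {S : Set V} {χ : V} (h : χ ∈ S) : C.e χ ∈ C.rootSpan S :=
  Submodule.subset_span ⟨χ, h, rfl⟩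

lemma rootSpan_mono {S T : Set V} (h : S ⊆ T) : C.rootSpan S ≤ C.rootSpan T :=
  Submodule.span_mono (Set.image_mono h)

lemma rootSpan_union (S T : Set V) : C.rootSpan (S ∪ T) = C.rootSpan S ⊔ C.rootSpan T := by
  rw [rootSpan, Set.image_union, Submodule.span_union]; rfl

lemma disjoint_rootSpan {S T : Set V} (hS : S ⊆ C.Δ) (hT : T ⊆ C.Δ) (h : Disjoint S T) :
    Disjoint (C.rootSpan S) (C.rootSpan T) := by
  have key : ∀ {A : Set V}, A ⊆ C.Δ →
      C.e '' A = (fun φ : C.Δ => C.e φ) '' ((↑) ⁻¹' A) := by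
    intro A hA
    ext x
    constructor
    · rintro ⟨χ, hχ, rfl⟩
      exact ⟨⟨χ, hA hχ⟩, hχ, rfl⟩
    · rintro ⟨χ, hχ, rfl⟩
      exact ⟨χ, hχ, rfl⟩
  rw [rootSpan, rootSpan, key hS, key hT]
  exact C.indep.disjoint_span_image (h.preimage _)

lemma lie_mem_of_roots {S T : Set V} {U : Submodule ℂ L} (hS : S ⊆ C.Δ) (hT : T ⊆ C.Δ)
    (hopp : ∀ φ ∈ S, -φ ∈ T → C.H.toSubmodule ≤ U)
    (hadd : ∀ φ ∈ S, ∀ χ ∈ T, φ + χ ∈ C.Δ → C.e (φ + χ) ∈ U) {x y : L}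
    (hx : x ∈ C.rootSpan S) (hy : y ∈ C.rootSpan T) : ⁅x, y⁆ ∈ U := by
  refine lie_mem_of_mem_span ?_ hx hy
  rintro _ ⟨φ, hφ, rfl⟩ _ ⟨χ, hχ, rfl⟩
  by_cases h0 : φ + χ = 0
  · obtain rfl : χ = -φ := (neg_eq_of_add_eq_zero_right h0).symm
    exact hopp φ hφ hχ (C.bracket_opp φ (hS hφ))
  by_cases hmem : φ + χ ∈ C.Δ
  · obtain ⟨c, -, hc⟩ := C.bracket_add φ (hS hφ) χ (hT hχ) hmem
    rw [hc]
    exact U.smul_mem _ (hadd φ hφ χ hχ hmem)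
  · rw [C.bracket_zero φ (hS hφ) χ (hT hχ) hmem h0]; exact U.zero_mem

lemma lie_cartan_mem {S : Set V} (hS : S ⊆ C.Δ) {x y : L} (hx : x ∈ C.rootSpan S)
    (hy : y ∈ C.H) : ⁅x, y⁆ ∈ C.rootSpan S := by
  have hy' : y ∈ Submodule.span ℂ {y} := Submodule.mem_span_singleton_self y
  refine lie_mem_of_mem_span ?_ hx hy'
  rintro _ ⟨φ, hφ, rfl⟩ _ rfl
  rw [lie_cartan _ hy (hS hφ)]
  exact Submodule.smul_mem _ _ (e_mem_rootSpan hφ)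

lemma Φ_cartan {x : L} (hx : x ∈ C.H) : C.Φ x = 0 := C.Φ_b x (Submodule.mem_sup_left hx)

lemma Φ_pos {S : Set V} (hS : S ⊆ C.Pos) {x : L} (hx : x ∈ C.rootSpan S) : C.Φ x = 0 :=
  C.Φ_b x (Submodule.mem_sup_right (rootSpan_mono hS hx))

lemma Φ_eq_self {S : Set V} (hS : ∀ χ ∈ S, -χ ∈ C.Pos) {x : L} (hx : x ∈ C.rootSpan S) :
    C.Φ x = x :=
  C.Φ_neg x (rootSpan_mono (T := Neg.neg '' C.Pos) (fun χ hχ => ⟨-χ, hS χ hχ, neg_neg χ⟩) hx)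

lemma Φ_mem {S : Set V} (hS : S ⊆ C.Δ) {x : L} (hx : x ∈ C.H.toSubmodule ⊔ C.rootSpan S) :
    C.Φ x ∈ C.rootSpan {χ ∈ S | -χ ∈ C.Pos} := by
  obtain ⟨h, hh, y, hy, rfl⟩ := Submodule.mem_sup.1 hx
  rw [map_add, Φ_cartan hh, zero_add]
  have hle : S ⊆ {χ ∈ S | -χ ∈ C.Pos} ∪ C.Pos := fun χ hχ =>
    (pos_or_neg_pos (hS hχ)).elim Or.inr fun h => Or.inl ⟨hχ, h⟩
  have hy' := rootSpan_mono hle hy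
  rw [rootSpan_union] at hy'
  obtain ⟨p, hp, q, hq, rfl⟩ := Submodule.mem_sup.1 hy'
  rwa [map_add, Φ_eq_self (fun _ h => h.2) hp, Φ_pos subset_rfl hq, add_zero]

end CascadeLieData

namespace CascadeLieData

open RootSystemData

variable {V : Type*} [NormedAddCommGroup V] [InnerProductSpace ℝ V]
  {L : Type*} [LieRing L] [LieAlgebra ℂ L] (C : CascadeLieData V L)

/-- The positive roots in `W`. -/
def posIn (W : Submodule ℝ V) : Set V := {χ ∈ C.Pos | χ ∈ W}

/-- The roots in `W` having positive inner product with `β`. -/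
def upRoots (W : Submodule ℝ V) (β : V) : Set V := {χ ∈ C.Δ | χ ∈ W ∧ 0 < ⟪χ, β⟫_ℝ}

/-- The roots in `W` orthogonal to `β`. -/
def levelRoots (W : Submodule ℝ V) (β : V) : Set V := {χ ∈ C.Δ | χ ∈ W ∧ ⟪χ, β⟫_ℝ = 0}

/-- The roots in `W`, other than `-β`, having negative inner product with `β`. -/
def downRoots (W : Submodule ℝ V) (β : V) : Set V :=
  {χ ∈ C.Δ | χ ∈ W ∧ ⟪χ, β⟫_ℝ < 0 ∧ χ ≠ -β}

variable {C} {W : Submodule ℝ V} {β : V}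

lemma posIn_subset : C.posIn W ⊆ C.Δ := fun _ h => C.pos_subset h.1
lemma upRoots_subset : C.upRoots W β ⊆ C.Δ := fun _ h => h.1
lemma levelRoots_subset : C.levelRoots W β ⊆ C.Δ := fun _ h => h.1
lemma downRoots_subset : C.downRoots W β ⊆ C.Δ := fun _ h => h.1

lemma mem_perp {χ : V} : χ ∈ W ⊓ (Submodule.span ℝ {β})ᗮ ↔ χ ∈ W ∧ ⟪χ, β⟫_ℝ = 0 := by
  rw [Submodule.mem_inf, Submodule.mem_orthogonal_singleton_iff_inner_left]

lemma posIn_perp_subset : C.posIn (W ⊓ (Submodule.span ℝ {β})ᗮ) ⊆ C.levelRoots W β :=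
  fun _ h => ⟨C.pos_subset h.1, mem_perp.1 h.2⟩

section Brackets

variable {x y : L}

lemma lie_up_up (hx : x ∈ C.rootSpan (C.upRoots W β)) (hy : y ∈ C.rootSpan (C.upRoots W β)) :
    ⁅x, y⁆ ∈ C.rootSpan (C.upRoots W β) := by
  refine lie_mem_of_roots upRoots_subset upRoots_subset ?_ ?_ hx hy
  · rintro φ ⟨-, -, h⟩ ⟨-, -, h'⟩
    rw [inner_neg_left] at h'; linarith
  · rintro φ ⟨-, hW, h⟩ χ ⟨-, hW', h'⟩ hmem
    exact e_mem_rootSpan ⟨hmem, W.add_mem hW hW', by rw [inner_add_left]; linarith⟩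

lemma lie_up_level (hx : x ∈ C.rootSpan (C.upRoots W β))
    (hy : y ∈ C.rootSpan (C.levelRoots W β)) : ⁅x, y⁆ ∈ C.rootSpan (C.upRoots W β) := by
  refine lie_mem_of_roots upRoots_subset levelRoots_subset ?_ ?_ hx hy
  · rintro φ ⟨-, -, h⟩ ⟨-, -, h'⟩
    rw [inner_neg_left] at h'; linarith
  · rintro φ ⟨-, hW, h⟩ χ ⟨-, hW', h'⟩ hmem
    exact e_mem_rootSpan ⟨hmem, W.add_mem hW hW', by rw [inner_add_left]; linarith⟩

lemma lie_up_zero (hx : x ∈ C.rootSpan (C.upRoots W β))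
    (hy : y ∈ C.H.toSubmodule ⊔ C.rootSpan (C.levelRoots W β)) :
    ⁅x, y⁆ ∈ C.rootSpan (C.upRoots W β) := by
  obtain ⟨h, hh, y, hy', rfl⟩ := Submodule.mem_sup.1 hy
  rw [lie_add]
  exact Submodule.add_mem _ (lie_cartan_mem upRoots_subset hx hh) (lie_up_level hx hy')

lemma lie_zero_up (hx : x ∈ C.H.toSubmodule ⊔ C.rootSpan (C.levelRoots W β))
    (hy : y ∈ C.rootSpan (C.upRoots W β)) : ⁅x, y⁆ ∈ C.rootSpan (C.upRoots W β) := by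
  rw [← lie_skew]
  exact Submodule.neg_mem _ (lie_up_zero hy hx)

lemma lie_level_zero (hx : x ∈ C.rootSpan (C.levelRoots W β))
    (hy : y ∈ C.H.toSubmodule ⊔ C.rootSpan (C.levelRoots W β)) :
    ⁅x, y⁆ ∈ C.H.toSubmodule ⊔ C.rootSpan (C.levelRoots W β) := by
  obtain ⟨h, hh, y, hy', rfl⟩ := Submodule.mem_sup.1 hy
  rw [lie_add]
  refine Submodule.add_mem _
    (Submodule.mem_sup_right (lie_cartan_mem levelRoots_subset hx hh)) ?_
  refine lie_mem_of_roots levelRoots_subset levelRoots_subset (fun _ _ _ => le_sup_left) ?_ hx hy'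
  rintro φ ⟨-, hW, h⟩ χ ⟨-, hW', h'⟩ hmem
  exact Submodule.mem_sup_right
    (e_mem_rootSpan ⟨hmem, W.add_mem hW hW', by rw [inner_add_left, h, h', add_zero]⟩)

lemma lie_posIn_zero (hx : x ∈ C.rootSpan (C.posIn W)) (hy : y ∈ C.H.toSubmodule ⊔
    C.rootSpan (C.posIn W)) : ⁅x, y⁆ ∈ C.H.toSubmodule ⊔ C.rootSpan (C.posIn W) := by
  obtain ⟨h, hh, y, hy', rfl⟩ := Submodule.mem_sup.1 hy
  rw [lie_add]
  refine Submodule.add_mem _ (Submodule.mem_sup_right (lie_cartan_mem posIn_subset hx hh)) ?_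
  refine lie_mem_of_roots posIn_subset posIn_subset (fun _ _ _ => le_sup_left) ?_ hx hy'
  rintro φ ⟨h, hW⟩ χ ⟨h', hW'⟩ hmem
  exact Submodule.mem_sup_right
    (e_mem_rootSpan ⟨C.pos_add _ h _ h' hmem, W.add_mem hW hW'⟩)

end Brackets

section TopRoot

variable (D : C.IsTopRoot W β)
include D

lemma upRoots_subset_pos : C.upRoots W β ⊆ C.Pos := fun _ h => D.pos_of_inner_pos h.1 h.2.1 h.2.2

lemma posIn_subset_level_union_up :
    C.posIn W ⊆ C.posIn (W ⊓ (Submodule.span ℝ {β})ᗮ) ∪ C.upRoots W β := by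
  rintro χ ⟨hχ, hW⟩
  rcases (D.inner_nonneg hχ hW).eq_or_lt with h | h
  · exact Or.inl ⟨hχ, mem_perp.2 ⟨hW, h.symm⟩⟩
  · exact Or.inr ⟨C.pos_subset hχ, hW, h⟩

lemma lie_neg_down {x : L} (hx : x ∈ C.rootSpan (C.downRoots W β)) : ⁅C.e (-β), x⁆ = 0 := by
  have hf : C.e (-β) ∈ C.rootSpan {-β} := e_mem_rootSpan rfl
  rw [← Submodule.mem_bot (R := ℂ)]
  refine lie_mem_of_roots (by simpa using C.neg_mem _ D.root) downRoots_subset ?_ ?_ hf hx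
  · rintro _ rfl ⟨-, -, h, -⟩
    rw [neg_neg] at h
    linarith [D.inner_self_pos]
  · rintro _ rfl χ ⟨hχ, hW, h, -⟩ hmem
    refine absurd ?_ (D.add_notMem _ (D.neg_pos_of_inner_neg hχ hW h) (W.neg_mem hW))
    rw [← neg_neg (β + -χ), neg_add, neg_neg]
    exact C.neg_mem _ hmem

lemma lie_up_e {x : L} (hx : x ∈ C.rootSpan (C.upRoots W β)) : ⁅x, C.e β⁆ = 0 := by
  have hf : C.e β ∈ C.rootSpan {β} := e_mem_rootSpan rfl
  rw [← Submodule.mem_bot (R := ℂ)]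
  refine lie_mem_of_roots upRoots_subset (by simpa using D.root) ?_ ?_ hx hf
  · rintro φ ⟨-, -, h⟩ rfl
    rw [inner_neg_right] at h
    linarith [real_inner_self_nonneg (x := φ)]
  · rintro φ hφ _ rfl hmem
    refine absurd ?_ (D.add_notMem φ (upRoots_subset_pos D hφ) hφ.2.1)
    rwa [add_comm]

lemma lie_level_e {x : L} (hx : x ∈ C.rootSpan (C.levelRoots W β)) : ⁅x, C.e β⁆ = 0 := by
  have hf : C.e β ∈ C.rootSpan {β} := e_mem_rootSpan rfl
  rw [← Submodule.mem_bot (R := ℂ)]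
  refine lie_mem_of_roots levelRoots_subset (by simpa using D.root) ?_ ?_ hx hf
  · rintro φ ⟨-, -, h⟩ rfl
    rw [inner_neg_right] at h
    have := real_inner_self_pos.2 (ne_zero_of_mem D.root)
    rw [inner_neg_neg] at this
    linarith
  · rintro φ ⟨hφ, hW, h⟩ _ rfl hmem
    exact absurd hmem (D.add_notMem_of_orthogonal hφ hW h)

lemma lie_level_neg {x : L} (hx : x ∈ C.rootSpan (C.levelRoots W β)) : ⁅x, C.e (-β)⁆ = 0 := by
  have hf : C.e (-β) ∈ C.rootSpan {-β} := e_mem_rootSpan rfl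
  rw [← Submodule.mem_bot (R := ℂ)]
  refine lie_mem_of_roots levelRoots_subset (by simpa using C.neg_mem _ D.root) ?_ ?_ hx hf
  · rintro φ ⟨-, -, h⟩ h'
    obtain rfl : φ = β := by simpa using h'
    linarith [D.inner_self_pos]
  · rintro φ ⟨hφ, hW, h⟩ _ rfl hmem
    exact absurd hmem (D.sub_notMem_of_orthogonal hφ hW h)

lemma lie_posIn_e {x : L} (hx : x ∈ C.rootSpan (C.posIn W)) : ⁅x, C.e β⁆ = 0 := by
  have hx' := rootSpan_mono (posIn_subset_level_union_up D) hx
  rw [rootSpan_union] at hx'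
  obtain ⟨p, hp, q, hq, rfl⟩ := Submodule.mem_sup.1 hx'
  rw [add_lie, lie_level_e D (rootSpan_mono posIn_perp_subset hp), lie_up_e D hq, add_zero]

lemma lie_down_e {x : L} (hx : x ∈ C.rootSpan (C.downRoots W β)) :
    ⁅x, C.e β⁆ ∈ C.rootSpan (C.upRoots W β) := by
  have hf : C.e β ∈ C.rootSpan {β} := e_mem_rootSpan rfl
  have hb := D.inner_self_pos
  refine lie_mem_of_roots downRoots_subset (by simpa using D.root) ?_ ?_ hx hf
  · rintro φ ⟨-, -, -, h⟩ h'
    exact absurd (by rw [← Set.mem_singleton_iff.1 h', neg_neg]) h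
  · rintro φ ⟨hφ, hW, h, hne⟩ _ rfl hmem
    have := D.two_mul_inner_neg hφ hW h hne
    exact e_mem_rootSpan ⟨hmem, W.add_mem hW D.mem, by rw [inner_add_left]; linarith⟩

lemma cartan_bracket_mem : ⁅C.e (-β), C.e β⁆ ∈ C.H := by
  rw [← lie_skew]
  exact neg_mem (C.bracket_opp β D.root)

/-- The decomposition of the image of `e_{-β}` under the exponential of an element of the
nilradical. -/
lemma expNil_neg_sub_mem {z : L} (hz : z ∈ C.rootSpan (C.posIn W)) (K : ℕ) :
    expNil (LieAlgebra.ad ℂ L z) (K + 1) (C.e (-β)) - C.e (-β) ∈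
      C.rootSpan (C.downRoots W β) ⊔ (C.H.toSubmodule ⊔ C.rootSpan (C.levelRoots W β)) ⊔
        C.rootSpan (C.upRoots W β) := by
  have hnegΔ := C.neg_mem _ D.root
  set S : Set V := {χ ∈ C.Δ | χ ∈ W ∧ χ ≠ -β} with hS
  have hSΔ : S ⊆ C.Δ := fun _ h => h.1
  have hle : C.H.toSubmodule ⊔ C.rootSpan S ≤
      C.rootSpan (C.downRoots W β) ⊔ (C.H.toSubmodule ⊔ C.rootSpan (C.levelRoots W β)) ⊔
        C.rootSpan (C.upRoots W β) := by
    have h1 : S ⊆ C.downRoots W β ∪ C.levelRoots W β ∪ C.upRoots W β := by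
      rintro χ ⟨hχ, hW, hne⟩
      rcases lt_trichotomy ⟪χ, β⟫_ℝ 0 with h | h | h
      · exact Or.inl (Or.inl ⟨hχ, hW, h, hne⟩)
      · exact Or.inl (Or.inr ⟨hχ, hW, h⟩)
      · exact Or.inr ⟨hχ, hW, h⟩
    refine sup_le (le_sup_of_le_left (le_sup_of_le_right le_sup_left)) ((rootSpan_mono h1).trans ?_)
    rw [rootSpan_union, rootSpan_union]
    exact sup_le_sup_right (sup_le_sup_left le_sup_right _) _
  refine hle (expNil_apply_sub_mem (fun u hu => ?_) ?_ K)
  · obtain ⟨h, hh, y, hy, rfl⟩ := Submodule.mem_sup.1 hu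
    rw [LieAlgebra.ad_apply, lie_add]
    refine Submodule.add_mem _ (Submodule.mem_sup_right ?_) ?_
    · refine rootSpan_mono ?_ (lie_cartan_mem posIn_subset hz hh)
      rintro χ ⟨hχ, hW⟩
      exact ⟨C.pos_subset hχ, hW, fun h => C.not_neg_mem _ D.pos (h ▸ hχ)⟩
    · refine lie_mem_of_roots posIn_subset hSΔ (fun _ _ _ => le_sup_left) ?_ hz hy
      rintro φ ⟨hφ, hφW⟩ χ ⟨hχ, hχW, -⟩ hmem
      refine Submodule.mem_sup_right (e_mem_rootSpan ⟨hmem, W.add_mem hφW hχW, fun h => ?_⟩)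
      refine D.add_notMem φ hφ hφW ?_
      rw [← neg_neg (β + φ), neg_add, ← h, add_neg_cancel_comm]
      exact C.neg_mem _ hχ
  · have hf : C.e (-β) ∈ C.rootSpan {-β} := e_mem_rootSpan rfl
    refine lie_mem_of_roots posIn_subset (by simpa using hnegΔ) (fun _ _ _ => le_sup_left) ?_ hz hf
    rintro φ ⟨hφ, hφW⟩ _ rfl hmem
    refine Submodule.mem_sup_right (e_mem_rootSpan ⟨hmem, W.add_mem hφW (W.neg_mem D.mem), ?_⟩)
    intro h
    exact ne_zero_of_mem (C.pos_subset hφ) (by simpa using h)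

/-- The coefficient of `e_{-β}` in `[e_{-β}, [e_{-β}, e_β]]`. -/
lemma lie_neg_cartan : ⁅C.e (-β), ⁅C.e (-β), C.e β⁆⁆ =
    C.wt β ⟨_, cartan_bracket_mem D⟩ • C.e (-β) := by
  rw [lie_cartan _ (cartan_bracket_mem D) (C.neg_mem _ D.root), map_neg]
  simp

lemma wt_cartan_ne_zero {φ : V} (hφ : φ ∈ C.upRoots W β) (hne : φ ≠ β) :
    C.wt β ⟨_, cartan_bracket_mem D⟩ ≠ 0 := by
  have hb := D.inner_self_pos
  have hnegΔ := C.neg_mem _ D.root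
  have hφP := upRoots_subset_pos D hφ
  have h2 := D.two_mul_inner hφ.1 hφ.2.1 hφ.2.2 hne
  have hρ := sub_mem_of_inner_pos hφ.1 D.root hφ.2.2 hne
  have hρin : ⟪φ - β, β⟫_ℝ < 0 := by rw [inner_sub_left]; linarith
  have hρW := W.sub_mem hφ.2.1 D.mem
  obtain ⟨q, hq, hq'⟩ := C.bracket_add (-β) hnegΔ φ hφ.1 (by rwa [neg_add_eq_sub])
  rw [neg_add_eq_sub] at hq'
  obtain ⟨p, hp, hp'⟩ := C.bracket_add β D.root (φ - β) hρ (by simpa using hφ.1)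
  rw [add_sub_cancel] at hp'
  have h0 : ⁅C.e β, C.e φ⁆ = 0 := by
    rw [← lie_skew, lie_up_e D (e_mem_rootSpan hφ), neg_zero]
  have h0' : ⁅C.e (-β), C.e (φ - β)⁆ = 0 := by
    refine lie_neg_down D (e_mem_rootSpan ⟨hρ, hρW, hρin, fun h => ?_⟩)
    exact ne_zero_of_mem hφ.1 (by simpa [sub_eq_neg_self] using h)
  set k : C.H := ⟨_, cartan_bracket_mem D⟩ with hk
  have e1 : C.wt φ k = -(p * q) := by
    have := C.root_vec k φ hφ.1
    rw [show (k : L) = ⁅C.e (-β), C.e β⁆ from rfl, lie_lie, h0, lie_zero, hq', lie_smul, hp',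
      zero_sub, smul_smul, ← neg_smul] at this
    rw [← smul_left_injective ℂ (C.e_ne φ hφ.1) this]
    ring
  have e2 : C.wt (φ - β) k = p * q := by
    have := C.root_vec k _ hρ
    rw [show (k : L) = ⁅C.e (-β), C.e β⁆ from rfl, lie_lie, h0', lie_zero, hp', lie_smul, hq',
      sub_zero, smul_smul] at this
    exact (smul_left_injective ℂ (C.e_ne _ hρ) this).symm
  have e3 : C.wt β k = -2 * (p * q) := by
    rw [map_sub, LinearMap.sub_apply, e1] at e2
    linear_combination -e2
  rw [e3]
  exact mul_ne_zero (by norm_num) (mul_ne_zero hp hq)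

end TopRoot

end CascadeLieData

namespace CascadeLieData

open RootSystemData

variable {V : Type*} [NormedAddCommGroup V] [InnerProductSpace ℝ V]
  {L : Type*} [LieRing L] [LieAlgebra ℂ L] {C : CascadeLieData V L}
  {W : Submodule ℝ V} {β : V}

/-- If `v = e_{-β} + u + w + f` satisfies `[v, [v, e_β]] = c v`, then the component of `c w` in
the level of roots orthogonal to `β` is determined by `u`. -/
lemma smul_sub_lie_mem (D : C.IsTopRoot W β) {u w f : L} {c : ℂ}
    (hu : u ∈ C.rootSpan (C.downRoots W β))
    (hw : w ∈ C.H.toSubmodule ⊔ C.rootSpan (C.levelRoots W β))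
    (hf : f ∈ C.rootSpan (C.upRoots W β))
    (hc : ⁅C.e (-β), ⁅C.e (-β), C.e β⁆⁆ = c • C.e (-β))
    (hv : ⁅C.e (-β) + u + w + f, ⁅C.e (-β) + u + w + f, C.e β⁆⁆ =
      c • (C.e (-β) + u + w + f)) :
    c • w - ⁅u, ⁅u, C.e β⁆⁆ ∈
      C.rootSpan (C.downRoots W β) ⊔ (C.H.toSubmodule ⊔ C.rootSpan (C.upRoots W β)) := by
  set X := C.rootSpan (C.downRoots W β) ⊔ (C.H.toSubmodule ⊔ C.rootSpan (C.upRoots W β)) with hX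
  have hXd : C.rootSpan (C.downRoots W β) ≤ X := le_sup_left
  have hXH : C.H.toSubmodule ≤ X := le_sup_of_le_right le_sup_left
  have hXu : C.rootSpan (C.upRoots W β) ≤ X := le_sup_of_le_right le_sup_right
  set k := ⁅C.e (-β), C.e β⁆ with hk
  have hkH : k ∈ C.H := cartan_bracket_mem D
  have hub := lie_down_e D hu
  have hβup : C.e β ∈ C.rootSpan (C.upRoots W β) :=
    e_mem_rootSpan ⟨D.root, D.mem, D.inner_self_pos⟩
  have hfb := lie_up_e D hf
  obtain ⟨h, hh, y, hy, rfl⟩ := Submodule.mem_sup.1 hw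
  obtain ⟨l, hl⟩ : ∃ l : ℂ, ⁅h, C.e β⁆ = l • C.e β := ⟨_, C.root_vec ⟨h, hh⟩ β D.root⟩
  have hyb := lie_level_e D hy
  have hvb : ⁅C.e (-β) + u + (h + y) + f, C.e β⁆ = k + ⁅u, C.e β⁆ + l • C.e β := by
    rw [add_lie, add_lie, add_lie, add_lie, hl, hyb, hfb, add_zero, add_zero]
  have hfub : ⁅C.e (-β), ⁅u, C.e β⁆⁆ = ⁅u, k⁆ := by
    rw [leibniz_lie, lie_neg_down D hu, zero_lie, zero_add]
  have hyk : ⁅y, k⁆ = 0 := by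
    rw [hk, leibniz_lie, lie_level_neg D hy, zero_lie, hyb, lie_zero, zero_add]
  have h1 : ⁅u, k⁆ ∈ X := hXd (lie_cartan_mem downRoots_subset hu hkH)
  have h2 : ⁅h, k⁆ ∈ X := hXH (C.H.lie_mem hh hkH)
  have h3 : ⁅f, k⁆ ∈ X := hXu (lie_cartan_mem upRoots_subset hf hkH)
  have h4 : ⁅h + y, ⁅u, C.e β⁆⁆ ∈ X := hXu (lie_zero_up hw hub)
  have h5 : ⁅f, ⁅u, C.e β⁆⁆ ∈ X := hXu (lie_up_up hf hub)
  have h6 : l • (k + ⁅u, C.e β⁆ + l • C.e β) ∈ X := X.smul_mem _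
    (X.add_mem (X.add_mem (hXH hkH) (hXu hub)) (X.smul_mem _ (hXu hβup)))
  have h7 : c • u ∈ X := X.smul_mem _ (hXd hu)
  have h8 : c • f ∈ X := X.smul_mem _ (hXu hf)
  have key : c • (h + y) - ⁅u, ⁅u, C.e β⁆⁆ = ⁅u, k⁆ + ⁅h, k⁆ + ⁅f, k⁆ + ⁅u, k⁆ +
      ⁅h + y, ⁅u, C.e β⁆⁆ + ⁅f, ⁅u, C.e β⁆⁆ + l • (k + ⁅u, C.e β⁆ + l • C.e β) -
        c • u - c • f := by
    have hvv : ⁅C.e (-β) + u + (h + y) + f, k + ⁅u, C.e β⁆ + l • C.e β⁆ =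
        c • C.e (-β) + ⁅u, k⁆ + ⁅h, k⁆ + ⁅f, k⁆ + ⁅u, k⁆ + ⁅u, ⁅u, C.e β⁆⁆ +
          ⁅h + y, ⁅u, C.e β⁆⁆ + ⁅f, ⁅u, C.e β⁆⁆ + l • (k + ⁅u, C.e β⁆ + l • C.e β) := by
      rw [lie_add, lie_add, lie_smul, hvb]
      simp only [add_lie, hc, hyk, hfub]
      abel
    rw [hvb, hvv] at hv
    simp only [smul_add] at hv ⊢
    rw [← sub_eq_zero] at hv ⊢
    rw [← neg_eq_zero, ← hv]
    abel
  rw [key]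
  exact X.sub_mem (X.sub_mem (X.add_mem (X.add_mem (X.add_mem (X.add_mem (X.add_mem
    (X.add_mem h1 h2) h3) h1) h4) h5) h6) h7) h8

/-- When no root of `W` other than `β` has positive inner product with `β`, the coadjoint action
fixes `e_{-β}`. -/
lemma Φ_expNil_neg_eq_self (D : C.IsTopRoot W β) (hup : ∀ φ ∈ C.upRoots W β, φ = β) {z : L}
    (hz : z ∈ C.rootSpan (C.posIn W)) (K : ℕ) :
    C.Φ (expNil (LieAlgebra.ad ℂ L z) (K + 1) (C.e (-β))) = C.e (-β) := by
  have h : expNil (LieAlgebra.ad ℂ L z) (K + 1) (C.e (-β)) - C.e (-β) ∈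
      C.H.toSubmodule ⊔ C.rootSpan (C.posIn W) := by
    refine expNil_apply_sub_mem (fun u hu => lie_posIn_zero hz hu) ?_ K
    have hf : C.e (-β) ∈ C.rootSpan {-β} := e_mem_rootSpan rfl
    refine lie_mem_of_roots posIn_subset (by simpa using C.neg_mem _ D.root)
      (fun _ _ _ => le_sup_left) ?_ hz hf
    rintro φ ⟨hφ, hφW⟩ _ rfl hmem
    exfalso
    rcases (D.inner_nonneg hφ hφW).eq_or_lt with h | h
    · exact D.sub_notMem_of_orthogonal (C.pos_subset hφ) hφW h.symm hmem
    · rw [hup φ ⟨C.pos_subset hφ, hφW, h⟩, add_neg_cancel] at hmem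
      exact C.zero_not_mem hmem
  obtain ⟨p, hp, q, hq, hpq⟩ := Submodule.mem_sup.1 h
  rw [← eq_sub_iff_add_eq.1 hpq, map_add, map_add, Φ_cartan hp, Φ_pos (fun _ h => h.1) hq, zero_add,
    zero_add]
  refine Φ_eq_self (S := {-β}) ?_ (e_mem_rootSpan rfl)
  rintro _ rfl
  rw [neg_neg]
  exact D.pos

lemma eq_of_Φ_expNil_eq {K : ℕ} (hK : ∀ z ∈ C.nSub, (LieAlgebra.ad ℂ L z) ^ (K + 1) = 0)
    (D : C.IsTopRoot W β) {z z' t t' : L} {a a' : ℂ} (ha : a ≠ 0)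
    (hz : z ∈ C.rootSpan (C.posIn W)) (hz' : z' ∈ C.rootSpan (C.posIn W))
    (ht : t ∈ C.rootSpan (C.levelRoots W β)) (ht' : t' ∈ C.rootSpan (C.levelRoots W β))
    (h : C.Φ (expNil (LieAlgebra.ad ℂ L z) (K + 1) (a • C.e (-β) + t)) =
      C.Φ (expNil (LieAlgebra.ad ℂ L z') (K + 1) (a' • C.e (-β) + t'))) :
    a = a' ∧ ∃ y ∈ C.rootSpan (C.posIn (W ⊓ (Submodule.span ℝ {β})ᗮ)),
      ∃ y' ∈ C.rootSpan (C.posIn (W ⊓ (Submodule.span ℝ {β})ᗮ)),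
        C.Φ (expNil (LieAlgebra.ad ℂ L y) (K + 1) t) =
          C.Φ (expNil (LieAlgebra.ad ℂ L y') (K + 1) t') := by
  have hdown : ∀ χ ∈ C.downRoots W β, -χ ∈ C.Pos := fun χ hχ =>
    D.neg_pos_of_inner_neg hχ.1 hχ.2.1 hχ.2.2.1
  have hneg : C.Φ (C.e (-β)) = C.e (-β) := by
    refine Φ_eq_self (S := {-β}) ?_ (e_mem_rootSpan rfl)
    rintro _ rfl
    rw [neg_neg]
    exact D.pos
  -- replacing the exponent by its part orthogonal to `β`
  have hlevel : ∀ {z t : L}, z ∈ C.rootSpan (C.posIn W) → t ∈ C.rootSpan (C.levelRoots W β) →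
      ∃ y ∈ C.rootSpan (C.posIn (W ⊓ (Submodule.span ℝ {β})ᗮ)),
        C.Φ (expNil (LieAlgebra.ad ℂ L z) (K + 1) t) =
          C.Φ (expNil (LieAlgebra.ad ℂ L y) (K + 1) t) ∧
        C.Φ (expNil (LieAlgebra.ad ℂ L y) (K + 1) t) ∈ C.rootSpan (C.levelRoots W β) := by
    intro z t hz ht
    have hz1 := rootSpan_mono (posIn_subset_level_union_up D) hz
    rw [rootSpan_union] at hz1
    obtain ⟨y, hy, x, hx, rfl⟩ := Submodule.mem_sup.1 hz1
    have hy1 := rootSpan_mono posIn_perp_subset hy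
    have ht1 : t ∈ C.H.toSubmodule ⊔ C.rootSpan (C.levelRoots W β) := Submodule.mem_sup_right ht
    refine ⟨y, hy, ?_, ?_⟩
    · rw [← sub_eq_zero, ← map_sub, map_add]
      refine Φ_pos (upRoots_subset_pos D) (expNil_add_apply_sub_mem
        (fun p hp => lie_level_zero hy1 hp) (fun p hp => lie_up_zero hx hp) (fun p hp => ?_) ht1 _)
      exact Submodule.add_mem _ (lie_zero_up (Submodule.mem_sup_right hy1) hp) (lie_up_up hx hp)
    · exact rootSpan_mono (fun _ h => h.1) (Φ_mem levelRoots_subset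
        (expNil_apply_mem (fun p hp => lie_level_zero hy1 hp) ht1 _))
  have hdecomp : ∀ {z : L}, z ∈ C.rootSpan (C.posIn W) →
      ∃ u ∈ C.rootSpan (C.downRoots W β),
        ∃ w ∈ C.H.toSubmodule ⊔ C.rootSpan (C.levelRoots W β), ∃ f ∈ C.rootSpan (C.upRoots W β),
          expNil (LieAlgebra.ad ℂ L z) (K + 1) (C.e (-β)) = C.e (-β) + u + w + f := by
    intro z hz
    obtain ⟨x, hx, f, hf, hxf⟩ := Submodule.mem_sup.1 (expNil_neg_sub_mem D hz K)
    obtain ⟨u, hu, w, hw, rfl⟩ := Submodule.mem_sup.1 hx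
    refine ⟨u, hu, w, hw, f, hf, ?_⟩
    rw [← add_sub_cancel (C.e (-β)) (expNil _ _ _), ← hxf]
    abel
  obtain ⟨y, hy, hyt, hyl⟩ := hlevel hz ht
  obtain ⟨y', hy', hyt', hyl'⟩ := hlevel hz' ht'
  obtain ⟨u, hu, w, hw, f, hf, hv⟩ := hdecomp hz
  obtain ⟨u', hu', w', hw', f', hf', hv'⟩ := hdecomp hz'
  have hΦv : ∀ {u w f : L}, u ∈ C.rootSpan (C.downRoots W β) → f ∈ C.rootSpan (C.upRoots W β) →
      C.Φ (C.e (-β) + u + w + f) = C.e (-β) + u + C.Φ w := by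
    intro u w f hu hf
    rw [map_add, map_add, map_add, hneg, Φ_eq_self hdown hu, Φ_pos (upRoots_subset_pos D) hf,
      add_zero]
  have hwl := rootSpan_mono (fun _ h => h.1) (Φ_mem levelRoots_subset hw)
  have hwl' := rootSpan_mono (fun _ h => h.1) (Φ_mem levelRoots_subset hw')
  have h' := h
  rw [map_add, map_add, map_smul, map_smul, map_add, map_add, map_smul, map_smul, hyt, hyt', hv,
    hv', hΦv hu hf, hΦv hu' hf'] at h'
  set s := C.Φ (expNil (LieAlgebra.ad ℂ L y) (K + 1) t) with hs
  set s' := C.Φ (expNil (LieAlgebra.ad ℂ L y') (K + 1) t') with hs'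
  have hdl : Disjoint (C.rootSpan (C.downRoots W β)) (C.rootSpan (C.levelRoots W β)) := by
    refine disjoint_rootSpan downRoots_subset levelRoots_subset (Set.disjoint_left.2 ?_)
    rintro χ ⟨-, -, h, -⟩ ⟨-, -, h'⟩
    exact h.ne h'
  have hndl : Disjoint (C.rootSpan {-β})
      (C.rootSpan (C.downRoots W β) ⊔ C.rootSpan (C.levelRoots W β)) := by
    rw [← rootSpan_union]
    refine disjoint_rootSpan (by simpa using C.neg_mem _ D.root)
      (Set.union_subset downRoots_subset levelRoots_subset) (Set.disjoint_left.2 ?_)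
    rintro _ rfl (⟨-, -, -, h⟩ | ⟨-, -, h⟩)
    · exact h rfl
    · rw [inner_neg_left] at h
      linarith [D.inner_self_pos]
  have haa : a = a' := by
    have e : (a - a') • C.e (-β) = (a' • u' - a • u) + (a' • C.Φ w' + s' - (a • C.Φ w + s)) := by
      simp only [smul_add] at h'
      rw [sub_smul, ← sub_eq_zero, ← sub_eq_zero.2 h']
      abel
    have h0 : (a - a') • C.e (-β) = 0 := by
      refine Submodule.disjoint_def.1 hndl _ (Submodule.smul_mem _ _ (e_mem_rootSpan rfl)) ?_
      rw [e]
      refine Submodule.add_mem_sup (Submodule.sub_mem _ (Submodule.smul_mem _ _ hu')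
        (Submodule.smul_mem _ _ hu)) (Submodule.sub_mem _ ?_ ?_)
      · exact Submodule.add_mem _ (Submodule.smul_mem _ _ hwl') hyl'
      · exact Submodule.add_mem _ (Submodule.smul_mem _ _ hwl) hyl
    exact sub_eq_zero.1 ((smul_eq_zero.1 h0).resolve_right (C.e_ne _ (C.neg_mem _ D.root)))
  subst haa
  have huu : u = u' := by
    have e : a • (u - u') = a • C.Φ w' + s' - (a • C.Φ w + s) := by
      simp only [smul_add] at h'
      rw [smul_sub, ← sub_eq_zero, ← sub_eq_zero.2 h']
      abel
    have h0 : a • (u - u') = 0 := by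
      refine Submodule.disjoint_def.1 hdl _ (Submodule.smul_mem _ _ (Submodule.sub_mem _ hu hu')) ?_
      rw [e]
      exact Submodule.sub_mem _ (Submodule.add_mem _ (Submodule.smul_mem _ _ hwl') hyl')
        (Submodule.add_mem _ (Submodule.smul_mem _ _ hwl) hyl)
    exact sub_eq_zero.1 ((smul_eq_zero.1 h0).resolve_left ha)
  subst huu
  have hww : C.Φ w = C.Φ w' := by
    by_cases hup : ∀ φ ∈ C.upRoots W β, φ = β
    · have e := Φ_expNil_neg_eq_self D hup hz K
      have e' := Φ_expNil_neg_eq_self D hup hz' K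
      rw [hv, hΦv hu hf] at e
      rw [hv', hΦv hu hf'] at e'
      exact add_left_cancel (e.trans e'.symm)
    push Not at hup
    obtain ⟨φ, hφ, hne⟩ := hup
    have hc := wt_cartan_ne_zero D hφ hne
    have hcc := lie_neg_cartan D
    set c := C.wt β ⟨_, cartan_bracket_mem D⟩ with hcdef
    have hquad : ∀ {z v : L}, z ∈ C.rootSpan (C.posIn W) →
        expNil (LieAlgebra.ad ℂ L z) (K + 1) (C.e (-β)) = v → ⁅v, ⁅v, C.e β⁆⁆ = c • v := by
      rintro z _ hz rfl
      have hzK := hK z (rootSpan_mono (fun _ h => h.1) hz)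
      have hfix : expNil (LieAlgebra.ad ℂ L z) (K + 1) (C.e β) = C.e β :=
        expNil_apply_eq_self (lie_posIn_e D hz) K
      conv_lhs => rw [← hfix]
      rw [← expNil_ad_lie hzK, ← expNil_ad_lie hzK, hcc, map_smul]
    have m := smul_sub_lie_mem D hu hw hf hcc (hquad hz hv)
    have m' := smul_sub_lie_mem D hu hw' hf' hcc (hquad hz' hv')
    have m2 := Submodule.sub_mem _ m m'
    rw [sub_sub_sub_cancel_right, ← smul_sub, Submodule.smul_mem_iff _ hc] at m2
    obtain ⟨p, hp, q, hq, hpq⟩ := Submodule.mem_sup.1 m2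
    obtain ⟨r, hr, q, hq', rfl⟩ := Submodule.mem_sup.1 hq
    have hΦ := congrArg C.Φ hpq
    rw [map_add, map_add, Φ_eq_self hdown hp, Φ_cartan hr, Φ_pos (upRoots_subset_pos D) hq',
      add_zero, add_zero, map_sub] at hΦ
    have hp0 := Submodule.disjoint_def.1 hdl p hp (by rw [hΦ]; exact Submodule.sub_mem _ hwl hwl')
    exact sub_eq_zero.1 (by rw [← hΦ, hp0])
  refine ⟨rfl, y, hy, y', hy', ?_⟩
  rw [hww] at h'
  exact add_left_cancel h'

end CascadeLieData

namespace CascadeLieData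

open RootSystemData

variable {V : Type*} [NormedAddCommGroup V] [InnerProductSpace ℝ V]
  {L : Type*} [LieRing L] [LieAlgebra ℂ L] {C : CascadeLieData V L}

variable (C) in
lemma finite_cascade : C.cascade.Finite :=
  C.finite.subset (cascade_subset_pos.trans C.pos_subset)

open Classical in
variable (C) in
/-- The part in `W` of the element of `𝔯₋` with coefficients `a`. -/
noncomputable def cascadeSum (a : V → ℂ) (W : Submodule ℝ V) : L :=
  ∑ β ∈ C.finite_cascade.toFinset with β ∈ W, a β • C.e (-β)

lemma cascadeSum_top (a : V → ℂ) :
    C.cascadeSum a ⊤ = ∑ β ∈ C.finite_cascade.toFinset, a β • C.e (-β) := by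
  simp [cascadeSum]

lemma cascadeSum_eq_add (a : V → ℂ) {W : Submodule ℝ V} {β : V} (hβ : β ∈ C.cascade)
    (hW : β ∈ W) : C.cascadeSum a W =
      a β • C.e (-β) + C.cascadeSum a (W ⊓ (Submodule.span ℝ {β})ᗮ) := by
  classical
  have h0 : ⟪β, β⟫_ℝ ≠ 0 := (inner_self_pos_of_mem (C.pos_subset (cascade_subset_pos hβ))).ne'
  have hins : {b ∈ C.finite_cascade.toFinset | b ∈ W} =
      insert β {b ∈ C.finite_cascade.toFinset | b ∈ W ⊓ (Submodule.span ℝ {β})ᗮ} := by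
    ext b
    simp only [Finset.mem_filter, Finset.mem_insert, Set.Finite.mem_toFinset, mem_perp]
    constructor
    · rintro ⟨hb, hbW⟩
      by_cases h : b = β
      · exact Or.inl h
      · exact Or.inr ⟨hb, hbW, cascade_orthogonal hb hβ h⟩
    · rintro (rfl | ⟨hb, hbW, -⟩)
      · exact ⟨hβ, hW⟩
      · exact ⟨hb, hbW⟩
  have hnot : β ∉ {b ∈ C.finite_cascade.toFinset | b ∈ W ⊓ (Submodule.span ℝ {β})ᗮ} := by
    rw [Finset.mem_filter, mem_perp]
    exact fun h => h0 h.2.2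
  rw [cascadeSum, hins, Finset.sum_insert hnot, cascadeSum]

lemma cascadeSum_mem (a : V → ℂ) (W : Submodule ℝ V) (β : V) :
    C.cascadeSum a (W ⊓ (Submodule.span ℝ {β})ᗮ) ∈ C.rootSpan (C.levelRoots W β) := by
  classical
  refine Submodule.sum_mem _ fun b hb => Submodule.smul_mem _ _ (e_mem_rootSpan ?_)
  rw [Finset.mem_filter, Set.Finite.mem_toFinset, mem_perp] at hb
  obtain ⟨h1, h2, h3⟩ := hb
  exact ⟨C.neg_mem _ (C.pos_subset (cascade_subset_pos h1)), W.neg_mem h2,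
    by rw [inner_neg_left, h3, neg_zero]⟩

lemma coeff_eq_of_dominant {K : ℕ} (hK : ∀ z ∈ C.nSub, (LieAlgebra.ad ℂ L z) ^ (K + 1) = 0)
    {a a' : V → ℂ} (ha : ∀ β ∈ C.cascade, a β ≠ 0) {l : List V} (hl : ∀ b ∈ l, b ∈ C.cascade)
    {W : Submodule ℝ V} (hdom : C.Dominant W l) {z z' : L} (hz : z ∈ C.rootSpan (C.posIn W))
    (hz' : z' ∈ C.rootSpan (C.posIn W))
    (h : C.Φ (expNil (LieAlgebra.ad ℂ L z) (K + 1) (C.cascadeSum a W)) =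
      C.Φ (expNil (LieAlgebra.ad ℂ L z') (K + 1) (C.cascadeSum a' W))) :
    ∀ b ∈ l, a b = a' b := by
  induction l generalizing W z z' with
  | nil => simp
  | cons β t ih =>
    obtain ⟨hW, hpos, hadd, ht⟩ := hdom
    have hβ := hl β List.mem_cons_self
    rw [cascadeSum_eq_add a hβ hW, cascadeSum_eq_add a' hβ hW] at h
    obtain ⟨e, y, hy, y', hy', hyy⟩ := eq_of_Φ_expNil_eq hK ⟨hW, hpos, hadd⟩ (ha β hβ) hz hz'
      (cascadeSum_mem a W β) (cascadeSum_mem a' W β) h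
    intro b hb
    rcases List.mem_cons.1 hb with rfl | hb
    · exact e
    · exact ih (fun b hb => hl b (List.mem_cons_of_mem _ hb)) ht hy hy' hyy b hb

/-- An element of `𝔯₋` with nonzero coefficients is determined within `𝔯₋` by its coadjoint
orbit. -/
lemma cascadeSum_eq_of_Φ_expNil_eq {a a' : V → ℂ} (ha : ∀ β ∈ C.cascade, a β ≠ 0) {z z' : L}
    (hz : z ∈ C.nSub) (hz' : z' ∈ C.nSub) {N N' : ℕ} (hN : (LieAlgebra.ad ℂ L z) ^ N = 0)
    (hN' : (LieAlgebra.ad ℂ L z') ^ N' = 0)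
    (h : C.Φ (expNil (LieAlgebra.ad ℂ L z) N (C.cascadeSum a ⊤)) =
      C.Φ (expNil (LieAlgebra.ad ℂ L z') N' (C.cascadeSum a' ⊤))) :
    C.cascadeSum a ⊤ = C.cascadeSum a' ⊤ := by
  obtain ⟨K, hK⟩ := C.exists_ad_pow_eq_zero
  have hK' : ∀ z ∈ C.nSub, (LieAlgebra.ad ℂ L z) ^ (K + 1) = 0 := fun z hz => by
    rw [pow_succ, hK z hz, zero_mul]
  rw [expNil_eq hN (hK' z hz), expNil_eq hN' (hK' z' hz')] at h
  have htop : C.Pos ⊆ C.posIn ⊤ := fun χ hχ => ⟨hχ, Submodule.mem_top⟩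
  rw [cascadeSum_top, cascadeSum_top]
  refine Finset.sum_congr rfl fun β hβ => ?_
  obtain ⟨l, hβl, hl, hdom⟩ := exists_dominant_of_mem_cascade (C.finite_cascade.mem_toFinset.1 hβ)
  rw [coeff_eq_of_dominant hK' ha hl hdom (rootSpan_mono htop hz) (rootSpan_mono htop hz') h β hβl]

lemma exists_cascadeSum_of_mem_rMinus {x : L} (hx : x ∈ C.rMinus) :
    ∃ a, x = C.cascadeSum a ⊤ := by
  simp only [cascadeSum_top]
  induction hx using Submodule.span_induction with
  | mem x hx =>
    classical
    obtain ⟨_, ⟨β, hβ, rfl⟩, rfl⟩ := hx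
    refine ⟨Pi.single β 1, ?_⟩
    rw [Finset.sum_eq_single_of_mem β (C.finite_cascade.mem_toFinset.2 hβ)
      fun b _ hb => by rw [Pi.single_eq_of_ne hb, zero_smul]]
    simp
  | zero => exact ⟨0, by simp⟩
  | add x y _ _ h1 h2 =>
    obtain ⟨a, rfl⟩ := h1
    obtain ⟨b, rfl⟩ := h2
    exact ⟨a + b, by simp [add_smul, Finset.sum_add_distrib]⟩
  | smul c x _ h =>
    obtain ⟨a, rfl⟩ := h
    exact ⟨c • a, by simp [Finset.smul_sum, mul_smul]⟩

lemma exists_cascadeSum_of_mem_rMinusX {x : L} (hx : x ∈ C.rMinusX) :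
    ∃ a : V → ℂ, (∀ β ∈ C.cascade, a β ≠ 0) ∧ x = C.cascadeSum a ⊤ := by
  obtain ⟨a, ha, rfl⟩ := hx
  exact ⟨a, ha, by rw [cascadeSum_top, finsum_mem_eq_finite_toFinset_sum _ C.finite_cascade]⟩

end CascadeLieData

/-- For `τ ∈ 𝔯₋ˣ` and `z ∈ 𝔫` (with `ad z` nilpotent so that `exp(ad z)`
is defined): if `Φ(exp(ad z)(τ)) ∈ 𝔯₋` then `Φ(exp(ad z)(τ)) = τ`.  Consequently the
coadjoint `N`-orbits of distinct `τ, τ′ ∈ 𝔯₋ˣ` are disjoint. -/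
theorem statement14 {V : Type*} [NormedAddCommGroup V] [InnerProductSpace ℝ V]
    {L : Type*} [LieRing L] [LieAlgebra ℂ L] [Module.Finite ℂ L]
    (C : CascadeLieData V L) (τ : L) (hτ : τ ∈ C.rMinusX) :
    (∀ z ∈ C.nSub, ∀ N : ℕ, (LieAlgebra.ad ℂ L z) ^ N = 0 →
      C.Φ (expNil (LieAlgebra.ad ℂ L z) N τ) ∈ C.rMinus →
      C.Φ (expNil (LieAlgebra.ad ℂ L z) N τ) = τ) ∧
    (∀ τ' ∈ C.rMinusX, τ ≠ τ' → coadjointOrbit C τ ∩ coadjointOrbit C τ' = ∅) := by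
  obtain ⟨a, ha, rfl⟩ := CascadeLieData.exists_cascadeSum_of_mem_rMinusX hτ
  refine ⟨fun z hz N hN hmem => ?_, fun τ' hτ' hne => ?_⟩
  · obtain ⟨b, hb⟩ := CascadeLieData.exists_cascadeSum_of_mem_rMinus hmem
    have hbΦ : C.Φ (C.cascadeSum b ⊤) = C.cascadeSum b ⊤ := by
      refine C.Φ_neg _ (Submodule.span_mono ?_ (hb ▸ hmem))
      exact Set.image_mono (Set.image_mono RootSystemData.cascade_subset_pos)
    rw [hb]
    refine (CascadeLieData.cascadeSum_eq_of_Φ_expNil_eq ha hz C.nSub.zero_mem hN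
      (N' := 1) (by simp) ?_).symm
    rw [hb, expNil_apply_eq_self (N := 0) (by simp), hbΦ]
  · obtain ⟨b, hb, rfl⟩ := CascadeLieData.exists_cascadeSum_of_mem_rMinusX hτ'
    rw [Set.eq_empty_iff_forall_notMem]
    rintro x ⟨⟨z, hz, N, hN, hx⟩, z', hz', N', hN', hx'⟩
    exact hne (CascadeLieData.cascadeSum_eq_of_Φ_expNil_eq ha hz hz' hN hN' (hx.symm.trans hx'))
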